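/- Let α ∈ ℝ with |α| ∈ (0,1/2), let f(z) = ((z−1)/(z+1))^α be the holomorphic branch on ℂ∖[−1,1] with f(∞) = 1, let Q_{n,0}, Q_{n,1}, Q_{n,2} be type I Hermite–Padé polynomials of order n for (1, f, f²), and set ρ_n(z) = Q_{n,1}(z) + 2cos(απ) Q_{n,2}(z) f_0(z), holomorphic on ℂ∖F. Then the measures (1/(2n)) Σ_{x : ρ_n(x)=0} δ_x (zeros counted with multiplicity) converge, as n → ∞, to the absolutely continuous probability measure λ supported on [−1,1] with density λ'(x) = (√3/(4π)) · (1−x²)^{−1/3} · [ (1−x)^{−1/3} + (1+x)^{−1/3} ], x ∈ (−1,1); that is, for every continuous compactly supported function φ on ℂ, (1/(2n)) Σ_{x : ρ_n(x)=0} φ(x) → ∫_{−1}^{1} φ(x) λ'(x) dx. -/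

import Mathlib

open Polynomial Filter Asymptotics Bornology Topology MeasureTheory

/-- The density `λ'(x) = (√3/(4π)) (1−x²)^{−1/3} [(1−x)^{−1/3} + (1+x)^{−1/3}]` of the
limit zero distribution `λ` on `(−1,1)`. -/
noncomputable def lambdaDensity (x : ℝ) : ℝ :=
  Real.sqrt 3 / (4 * Real.pi) * (1 - x ^ 2) ^ (-(1 / 3) : ℝ) *
    ((1 - x) ^ (-(1 / 3) : ℝ) + (1 + x) ^ (-(1 / 3) : ℝ))

namespace HP

/-- the weight -/
noncomputable def W (β x : ℝ) : ℝ := ((1 - x) / (1 + x)) ^ β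

lemma W_pos {β x : ℝ} (hx : x ∈ Set.Ioo (-1 : ℝ) 1) : 0 < W β x := by
  unfold W
  have h1 := hx.1
  have h2 := hx.2
  exact Real.rpow_pos_of_pos (div_pos (by linarith) (by linarith)) _

lemma W_cont (β : ℝ) : ContinuousOn (W β) (Set.Ioo (-1 : ℝ) 1) := by
  unfold W
  apply ContinuousOn.rpow_const
  · apply ContinuousOn.div (by fun_prop) (by fun_prop)
    intro x hx
    have := hx.1
    linarith
  · intro x hx
    left
    have h1 := hx.1
    have h2 := hx.2
    exact (div_pos (by linarith) (by linarith)).ne'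

noncomputable def bker (β s : ℝ) : ℝ := s ^ β * (1 - s) ^ (-β - 1)

lemma bker_integrable {β : ℝ} (h1 : -1 < β) (h0 : β < 0) :
    IntegrableOn (bker β) (Set.Ioo 0 1) := by
  have h := Complex.betaIntegral_convergent (u := ((β + 1 : ℝ) : ℂ)) (v := ((-β : ℝ) : ℂ))
    (by simpa using by linarith) (by simpa using h0)
  rw [intervalIntegrable_iff_integrableOn_Ioo_of_le (by norm_num)] at h
  have h2 : IntegrableOn (fun x : ℝ => RCLike.re ((x : ℂ) ^ (((β + 1 : ℝ) : ℂ) - 1) *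
      (1 - (x : ℂ)) ^ (((-β : ℝ) : ℂ) - 1))) (Set.Ioo 0 1) := h.re
  refine (h2.congr_fun ?_ measurableSet_Ioo)
  intro x hx
  simp only [RCLike.re_to_complex, bker]
  have e1 : ((x : ℂ) ^ (((β + 1 : ℝ) : ℂ) - 1)) = ((x ^ β : ℝ) : ℂ) := by
    rw [Complex.ofReal_cpow hx.1.le]; congr 1; push_cast; ring
  have e2 : ((1 - x : ℂ) ^ (((-β : ℝ) : ℂ) - 1)) = (((1 - x) ^ (-β - 1) : ℝ) : ℂ) := by
    rw [Complex.ofReal_cpow (by linarith [hx.2])]; congr 1 <;> push_cast <;> ring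
  rw [e1, e2, ← Complex.ofReal_mul, Complex.ofReal_re]

lemma bker_integral {β : ℝ} (h1 : -1 < β) (h0 : β < 0) :
    ∫ s in Set.Ioo (0:ℝ) 1, bker β s = - Real.pi / Real.sin (Real.pi * β) := by
  have h := Complex.Gamma_mul_Gamma_eq_betaIntegral (s := ((β + 1 : ℝ) : ℂ)) (t := ((-β : ℝ) : ℂ))
    (by simpa using by linarith) (by simpa using h0)
  have hs : ((β + 1 : ℝ) : ℂ) + ((-β : ℝ) : ℂ) = 1 := by push_cast; ring
  have ht : ((-β : ℝ) : ℂ) = 1 - ((β + 1 : ℝ) : ℂ) := by push_cast; ring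
  rw [hs, Complex.Gamma_one, one_mul] at h
  have hR : Complex.Gamma ((β + 1 : ℝ) : ℂ) * Complex.Gamma ((-β : ℝ) : ℂ)
     = Real.pi / Complex.sin (Real.pi * ((β + 1 : ℝ) : ℂ)) := by
    rw [ht, Complex.Gamma_mul_Gamma_one_sub]
  rw [h] at hR
  have hI : Complex.betaIntegral ((β + 1 : ℝ) : ℂ) ((-β : ℝ) : ℂ)
     = ((∫ s in Set.Ioo (0:ℝ) 1, bker β s : ℝ) : ℂ) := by
    rw [Complex.betaIntegral, intervalIntegral.integral_of_le (by norm_num),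
      integral_Ioc_eq_integral_Ioo, ← integral_complex_ofReal]
    refine setIntegral_congr_fun measurableSet_Ioo ?_
    intro x hx
    simp only [bker]
    have e1 : ((x : ℂ) ^ (((β + 1 : ℝ) : ℂ) - 1)) = ((x ^ β : ℝ) : ℂ) := by
      rw [Complex.ofReal_cpow hx.1.le]; congr 1; push_cast; ring
    have e2 : ((1 - x : ℂ) ^ (((-β : ℝ) : ℂ) - 1)) = (((1 - x) ^ (-β - 1) : ℝ) : ℂ) := by
      rw [Complex.ofReal_cpow (by linarith [hx.2])]; congr 1 <;> push_cast <;> ring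
    rw [e1, e2, ← Complex.ofReal_mul]
  rw [hI] at hR
  have : ((∫ s in Set.Ioo (0:ℝ) 1, bker β s : ℝ) : ℂ)
      = ((Real.pi / Real.sin (Real.pi * (β + 1)) : ℝ) : ℂ) := by
    rw [hR]; push_cast; rfl
  have h3 := Complex.ofReal_injective this
  rw [h3, mul_add, mul_one, Real.sin_add_pi, div_neg, neg_div]

noncomputable def mob (v s : ℝ) : ℝ := ((1 - s) - v * s) / ((1 - s) + v * s)

lemma mob_den {v s : ℝ} (hv : 0 < v) (hs : s ∈ Set.Ioo (0:ℝ) 1) : 0 < (1 - s) + v * s := by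
  have := mul_pos hv hs.1
  linarith [hs.2]

lemma mob_image {v : ℝ} (hv : 0 < v) : mob v '' Set.Ioo 0 1 = Set.Ioo (-1) 1 := by
  ext x
  constructor
  · rintro ⟨s, hs, rfl⟩
    have hD := mob_den hv hs
    have := mul_pos hv hs.1
    unfold mob
    constructor
    · rw [lt_div_iff₀ hD]; linarith [hs.2]
    · rw [div_lt_iff₀ hD]; linarith [hs.2]
  · intro hx
    have h1 := hx.1
    have h2 := hx.2
    have hD : 0 < (1 - x) + v * (1 + x) := by
      have := mul_pos hv (show 0 < 1 + x by linarith)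
      linarith
    refine ⟨(1 - x) / ((1 - x) + v * (1 + x)), ⟨div_pos (by linarith) hD, ?_⟩, ?_⟩
    · rw [div_lt_one hD]
      have := mul_pos hv (show 0 < 1 + x by linarith)
      linarith
    · unfold mob
      have h3 : (1 - (1 - x) / ((1 - x) + v * (1 + x))) = v * (1 + x) / ((1 - x) + v * (1 + x)) := by
        field_simp; ring
      rw [h3]
      field_simp
      ring

lemma mob_deriv {v s : ℝ} (hv : 0 < v) (hs : s ∈ Set.Ioo (0:ℝ) 1) :
    HasDerivAt (mob v) (-(2 * v) / ((1 - s) + v * s) ^ 2) s := by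
  have hD := mob_den hv hs
  unfold mob
  have h1 : HasDerivAt (fun s : ℝ => (1 - s) - v * s) (-1 - v * 1) s :=
    ((hasDerivAt_id s).const_sub 1).sub ((hasDerivAt_id s).const_mul v)
  have h2 : HasDerivAt (fun s : ℝ => (1 - s) + v * s) (-1 + v * 1) s :=
    ((hasDerivAt_id s).const_sub 1).add ((hasDerivAt_id s).const_mul v)
  convert! h1.div h2 hD.ne' using 1
  ring

lemma mob_inj {v : ℝ} (hv : 0 < v) : Set.InjOn (mob v) (Set.Ioo 0 1) := by
  intro a ha b hb hab
  have h1 := mob_den hv ha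
  have h2 := mob_den hv hb
  unfold mob at hab
  rw [div_eq_div_iff h1.ne' h2.ne'] at hab
  have : v * (a - b) = 0 := by linarith
  rcases mul_eq_zero.1 this with h | h
  · exact absurd h hv.ne'
  · linarith

lemma mob_W {v s β : ℝ} (hv : 0 < v) (hs : s ∈ Set.Ioo (0:ℝ) 1) :
    W β (mob v s) = v ^ β * s ^ β * (1 - s) ^ (-β) := by
  have hD := mob_den hv hs
  have h1 : 0 < 1 - s := by linarith [hs.2]
  have e2 : 1 + mob v s = 2 * (1 - s) / (1 - s + v * s) := by
    unfold mob
    rw [eq_div_iff hD.ne', add_mul, div_mul_cancel₀ _ hD.ne']; ring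
  have e3 : 1 - mob v s = 2 * (v * s) / (1 - s + v * s) := by
    unfold mob
    rw [eq_div_iff hD.ne', sub_mul, div_mul_cancel₀ _ hD.ne']; ring
  have : (1 - mob v s) / (1 + mob v s) = v * s / (1 - s) := by
    rw [e2, e3, div_div_div_cancel_right₀ hD.ne', mul_div_mul_left _ _ two_ne_zero]
  unfold W
  rw [this, Real.div_rpow (mul_pos hv hs.1).le h1.le, Real.mul_rpow hv.le hs.1.le,
    Real.rpow_neg h1.le]
  rfl

lemma Wd_eq {β : ℝ} : Set.EqOn (fun s => |(-(2 * 1) / ((1 - s) + 1 * s) ^ 2 : ℝ)| •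
    (W β (mob 1 s) / (1 + mob 1 s))) (bker β) (Set.Ioo 0 1) := by
  intro s hs
  have h1 : 0 < 1 - s := by linarith [hs.2]
  simp only
  rw [mob_W one_pos hs]
  unfold bker mob
  rw [Real.rpow_sub h1, Real.rpow_one, Real.one_rpow]
  have e : (1 - s + 1 * s) = 1 := by ring
  rw [e]
  have e2 : 1 + (1 - s - 1 * s) / 1 = 2 * (1 - s) := by ring
  rw [e2]
  norm_num
  field_simp

lemma Wd_integrable {β : ℝ} (h1 : -1 < β) (h0 : β < 0) :
    IntegrableOn (fun x => W β x / (1 + x)) (Set.Ioo (-1) 1) := by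
  rw [← mob_image one_pos, integrableOn_image_iff_integrableOn_abs_deriv_smul measurableSet_Ioo
    (fun x hx => (mob_deriv one_pos hx).hasDerivWithinAt) (mob_inj one_pos)]
  exact (bker_integrable h1 h0).congr_fun Wd_eq.symm measurableSet_Ioo

lemma Wd_integral {β : ℝ} (h1 : -1 < β) (h0 : β < 0) :
    ∫ x in Set.Ioo (-1 : ℝ) 1, W β x / (1 + x) = - Real.pi / Real.sin (Real.pi * β) := by
  rw [← bker_integral h1 h0, ← mob_image one_pos,
    integral_image_eq_integral_abs_deriv_smul measurableSet_Ioo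
    (fun x hx => (mob_deriv one_pos hx).hasDerivWithinAt) (mob_inj one_pos)]
  exact setIntegral_congr_fun measurableSet_Ioo Wd_eq

lemma Wdz_integral {β v : ℝ} (h1 : -1 < β) (h0 : β < 0) (hv : 0 < v) (hv1 : v < 1) :
    ∫ x in Set.Ioo (-1 : ℝ) 1, W β x / (1 + x) / ((1 + v) / (1 - v) - x)
      = - Real.pi / Real.sin (Real.pi * β) * (v ^ β * (1 - v) / 2) := by
  rw [← bker_integral h1 h0, ← mob_image hv,
    integral_image_eq_integral_abs_deriv_smul measurableSet_Ioo
    (fun x hx => (mob_deriv hv hx).hasDerivWithinAt) (mob_inj hv), ← integral_mul_const]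
  refine setIntegral_congr_fun measurableSet_Ioo ?_
  intro s hs
  have h1 : 0 < 1 - s := by linarith [hs.2]
  have h2 : 0 < 1 - v := by linarith
  have hD := mob_den hv hs
  simp only
  rw [mob_W hv hs]
  unfold bker
  rw [Real.rpow_sub h1, Real.rpow_one, abs_div, abs_neg, abs_of_pos (by positivity : 0 < 2 * v),
    abs_of_pos (by positivity)]
  have e2 : 1 + mob v s = 2 * (1 - s) / (1 - s + v * s) := by
    unfold mob
    rw [eq_div_iff hD.ne', add_mul, div_mul_cancel₀ _ hD.ne']; ring
  have e3 : (1 + v) / (1 - v) - mob v s = 2 * v / ((1 - v) * (1 - s + v * s)) := by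
    unfold mob
    field_simp; ring
  rw [e2, e3, smul_eq_mul]
  field_simp

lemma z_sub_pos {v x : ℝ} (hv : 0 < v) (hv1 : v < 1) (hx : x ∈ Set.Ioo (-1:ℝ) 1) :
    0 < (1 + v) / (1 - v) - x := by
  have : 1 < (1 + v) / (1 - v) := by
    rw [lt_div_iff₀ (by linarith)]; linarith
  linarith [hx.2]

lemma Wdz_integrable {β v : ℝ} (h1 : -1 < β) (h0 : β < 0) (hv : 0 < v) (hv1 : v < 1) :
    IntegrableOn (fun x => W β x / (1 + x) / ((1 + v) / (1 - v) - x)) (Set.Ioo (-1) 1) := by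
  apply Integrable.of_integral_ne_zero
  rw [Wdz_integral h1 h0 hv hv1]
  have : Real.sin (Real.pi * β) ≠ 0 := by
    have : 0 < Real.sin (Real.pi * (-β)) :=
      Real.sin_pos_of_pos_of_lt_pi (by have := Real.pi_pos; nlinarith) (by have := Real.pi_pos; nlinarith)
    rw [mul_neg, Real.sin_neg] at this
    linarith
  have h3 : 0 < v ^ β * (1 - v) / 2 := by
    have := Real.rpow_pos_of_pos hv β
    have h4 : 0 < 1 - v := by linarith
    positivity
  exact mul_ne_zero (div_ne_zero (neg_ne_zero.2 Real.pi_ne_zero) this) (ne_of_gt h3)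

/-- Integrability of `W β`, `|β| < 1`. -/
lemma W_integrable {β : ℝ} (h : |β| < 1) (hb : β ≠ 0) : IntegrableOn (W β) (Set.Ioo (-1) 1) := by
  obtain ⟨h1, h2⟩ := abs_lt.1 h
  rcases lt_or_gt_of_ne hb with h0 | h0
  · have hd := Wd_integrable h1 h0
    refine Integrable.mono' (hd.const_mul 2) ((W_cont β).aestronglyMeasurable measurableSet_Ioo) ?_
    refine ae_restrict_of_forall_mem measurableSet_Ioo fun x hx => ?_
    have := W_pos (β := β) hx
    rw [Real.norm_of_nonneg this.le, ← mul_div_assoc, le_div_iff₀ (by linarith [hx.1])]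
    nlinarith [hx.2]
  · have hd := Wd_integrable (β := β - 1) (by linarith) (by linarith)
    refine Integrable.mono' (hd.const_mul 2) ((W_cont β).aestronglyMeasurable measurableSet_Ioo) ?_
    refine ae_restrict_of_forall_mem measurableSet_Ioo fun x hx => ?_
    have h5 := W_pos (β := β) hx
    have h6 := W_pos (β := β - 1) hx
    have hp : 0 < (1 - x) / (1 + x) := div_pos (by linarith [hx.2]) (by linarith [hx.1])
    have : W β x = W (β - 1) x * ((1 - x) / (1 + x)) := by
      unfold W
      rw [← Real.rpow_add_one hp.ne']
      congr 1; ring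
    rw [Real.norm_of_nonneg h5.le, this, ← mul_div_assoc, ← mul_div_assoc]
    apply div_le_div_of_nonneg_right _ (by linarith [hx.1])
    nlinarith [hx.1]

/-- Lemma A. -/
lemma W_cauchy {β v : ℝ} (h : |β| < 1) (hb : β ≠ 0) (hv : 0 < v) (hv1 : v < 1) :
    ∫ x in Set.Ioo (-1 : ℝ) 1, W β x / ((1 + v) / (1 - v) - x)
      = Real.pi / Real.sin (Real.pi * β) * (1 - v ^ β) := by
  obtain ⟨h1, h2⟩ := abs_lt.1 h
  have hv2 : 0 < 1 - v := by linarith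
  rcases lt_or_gt_of_ne hb with h0 | h0
  · have : Set.EqOn (fun x => W β x / ((1 + v) / (1 - v) - x))
      (fun x => (2 / (1 - v)) * (W β x / (1 + x) / ((1 + v) / (1 - v) - x)) - W β x / (1 + x))
      (Set.Ioo (-1) 1) := by
      intro x hx
      have e1 := z_sub_pos hv hv1 hx
      have e2 : 0 < 1 + x := by linarith [hx.1]
      have e3 : (2 / (1 - v)) = ((1 + v) / (1 - v) - x) + (1 + x) := by field_simp; ring
      simp only
      rw [e3]
      generalize (1 + v) / (1 - v) - x = y at *
      field_simp
      ring
    rw [setIntegral_congr_fun measurableSet_Ioo this, integral_sub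
      ((Wdz_integrable h1 h0 hv hv1).const_mul _) (Wd_integrable h1 h0), integral_const_mul,
      Wdz_integral h1 h0 hv hv1, Wd_integral h1 h0]
    field_simp
    ring
  · have g1 : -1 < β - 1 := by linarith
    have g2 : β - 1 < 0 := by linarith
    have : Set.EqOn (fun x => W β x / ((1 + v) / (1 - v) - x))
      (fun x => W (β - 1) x / (1 + x) -
        (2 * v / (1 - v)) * (W (β - 1) x / (1 + x) / ((1 + v) / (1 - v) - x)))
      (Set.Ioo (-1) 1) := by
      intro x hx
      have e1 := z_sub_pos hv hv1 hx
      have e2 : 0 < 1 + x := by linarith [hx.1]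
      have e3 : (2 * v / (1 - v)) = ((1 + v) / (1 - v) - x) - (1 - x) := by field_simp; ring
      have hp : 0 < (1 - x) / (1 + x) := div_pos (by linarith [hx.2]) (by linarith [hx.1])
      have : W β x = W (β - 1) x * ((1 - x) / (1 + x)) := by
        unfold W
        rw [← Real.rpow_add_one hp.ne']
        congr 1; ring
      simp only
      rw [e3, this]
      generalize (1 + v) / (1 - v) - x = y at *
      field_simp
      ring
    rw [setIntegral_congr_fun measurableSet_Ioo this, integral_sub
      (Wd_integrable g1 g2) ((Wdz_integrable g1 g2 hv hv1).const_mul _), integral_const_mul,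
      Wdz_integral g1 g2 hv hv1, Wd_integral g1 g2]
    have e5 : Real.sin (Real.pi * (β - 1)) = - Real.sin (Real.pi * β) := by
      rw [mul_sub, mul_one, Real.sin_sub_pi]
    have e6 : v ^ β = v ^ (β - 1) * v := by
      rw [← Real.rpow_add_one hv.ne']; congr 1; ring
    rw [e5, e6, neg_div_neg_eq]
    field_simp

end HP

namespace HP

noncomputable def U (τ : ℕ → ℝ) : ℕ → ℝ → ℝ
  | 0 => fun y => Real.exp (τ 0 * y)
  | (m + 1) => fun y => ∫ x in (0:ℝ)..y, Real.exp (τ (m + 1) * (y - x)) * U τ m x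

lemma duhamel {G g : ℝ → ℝ} {τ : ℝ} (h0 : G 0 = 0) (hg : Continuous g)
    (hG : ∀ y, HasDerivAt G (τ * G y + g y) y) (y : ℝ) :
    G y = ∫ x in (0:ℝ)..y, Real.exp (τ * (y - x)) * g x := by
  have h1 : ∀ x, HasDerivAt (fun x => Real.exp (τ * (y - x)) * G x)
      (Real.exp (τ * (y - x)) * g x) x := by
    intro x
    have e : HasDerivAt (fun x => Real.exp (τ * (y - x))) (Real.exp (τ * (y - x)) * (τ * (0 - 1))) x :=
      (((hasDerivAt_const x y).sub (hasDerivAt_id x)).const_mul τ).exp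
    convert! e.mul (hG x) using 1
    ring
  have h2 := intervalIntegral.integral_eq_sub_of_hasDerivAt (a := 0) (b := y) (fun x _ => h1 x)
    (Continuous.intervalIntegrable (by fun_prop) _ _)
  rw [h2, h0]
  simp

lemma U_succ_deriv_aux {τ : ℝ} {g : ℝ → ℝ} (hg : Continuous g) (y : ℝ) :
    HasDerivAt (fun y => ∫ x in (0:ℝ)..y, Real.exp (τ * (y - x)) * g x)
      (τ * (∫ x in (0:ℝ)..y, Real.exp (τ * (y - x)) * g x) + g y) y := by
  have key : ∀ y, ∫ x in (0:ℝ)..y, Real.exp (τ * (y - x)) * g x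
      = Real.exp (τ * y) * ∫ x in (0:ℝ)..y, Real.exp (-(τ * x)) * g x := by
    intro y
    rw [← intervalIntegral.integral_const_mul]
    congr 1
    ext x
    rw [← mul_assoc, ← Real.exp_add]
    congr 2
    ring
  have hc : Continuous (fun x => Real.exp (-(τ * x)) * g x) := by fun_prop
  have h1 : HasDerivAt (fun y => ∫ x in (0:ℝ)..y, Real.exp (-(τ * x)) * g x)
      (Real.exp (-(τ * y)) * g y) y :=
    intervalIntegral.integral_hasDerivAt_right (hc.intervalIntegrable _ _)
      hc.stronglyMeasurable.stronglyMeasurableAtFilter hc.continuousAt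
  have h2 : HasDerivAt (fun y => Real.exp (τ * y)) (Real.exp (τ * y) * (τ * 1)) y :=
    ((hasDerivAt_id y).const_mul τ).exp
  simp_rw [key]
  convert! h2.mul h1 using 1
  have : Real.exp (τ * y) * (Real.exp (-(τ * y)) * g y) = g y := by
    rw [← mul_assoc, ← Real.exp_add]; simp
  rw [this]
  ring

lemma U_cont (τ : ℕ → ℝ) (m : ℕ) : Continuous (U τ m) := by
  induction m with
  | zero => simp only [U]; fun_prop
  | succ m ih =>
    simp only [U]
    exact continuous_iff_continuousAt.2 fun y => (U_succ_deriv_aux ih y).continuousAt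

lemma U_nonneg (τ : ℕ → ℝ) (m : ℕ) {y : ℝ} (hy : 0 ≤ y) : 0 ≤ U τ m y := by
  induction m generalizing y with
  | zero => simp only [U]; positivity
  | succ m ih =>
    simp only [U]
    apply intervalIntegral.integral_nonneg hy
    intro x hx
    exact mul_nonneg (Real.exp_pos _).le (ih hx.1)

lemma U_le {τ τ' : ℕ → ℝ} {C : ℝ} (h : ∀ i, τ i ≤ τ' i + C) (m : ℕ) {y : ℝ} (hy : 0 ≤ y) :
    U τ m y ≤ Real.exp (C * y) * U τ' m y := by
  induction m generalizing y with
  | zero =>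
    simp only [U]
    rw [← Real.exp_add]
    apply Real.exp_le_exp.2
    have := mul_le_mul_of_nonneg_right (h 0) hy
    linarith
  | succ m ih =>
    simp only [U]
    rw [← intervalIntegral.integral_const_mul]
    have c1 := U_cont τ m
    have c2 := U_cont τ' m
    apply intervalIntegral.integral_mono_on hy
      (Continuous.intervalIntegrable (by fun_prop) _ _)
      (Continuous.intervalIntegrable (by fun_prop) _ _)
    intro x hx
    have e : Real.exp (C * y) * (Real.exp (τ' (m + 1) * (y - x)) * U τ' m x)
       = Real.exp ((τ' (m + 1) + C) * (y - x)) * (Real.exp (C * x) * U τ' m x) := by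
      rw [← mul_assoc, ← mul_assoc, ← Real.exp_add, ← Real.exp_add]
      congr 2
      ring
    rw [e]
    apply mul_le_mul _ (ih hx.1) (U_nonneg _ _ hx.1) (Real.exp_pos _).le
    apply Real.exp_le_exp.2
    exact mul_le_mul_of_nonneg_right (h _) (by linarith [hx.2])

/-- the equally spaced knots -/
lemma U_explicit (m : ℕ) (y : ℝ) :
    U (fun i => -(i / 3 : ℝ)) m y = (3 * (1 - Real.exp (-(y / 3)))) ^ m / m.factorial := by
  induction m generalizing y with
  | zero => simp [U]
  | succ m ih =>
    have ih' : U (fun i => -(i / 3 : ℝ)) m =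
      fun y => (3 * (1 - Real.exp (-(y / 3)))) ^ m / m.factorial := funext ih
    simp only [U]
    rw [ih']
    symm
    refine duhamel (G := fun y => (3 * (1 - Real.exp (-(y / 3)))) ^ (m + 1) / (m + 1).factorial)
      ?_ ?_ ?_ y
    · simp
    · fun_prop
    · intro y
      have e0 : HasDerivAt (fun y : ℝ => Real.exp (-(y / 3))) (Real.exp (-(y / 3)) * (-(1 / 3))) y :=
        (((hasDerivAt_id y).div_const 3).neg).exp
      have e1 : HasDerivAt (fun y : ℝ => 3 * (1 - Real.exp (-(y / 3)))) (Real.exp (-(y / 3))) y := by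
        convert! (e0.const_sub 1).const_mul 3 using 1
        ring
      convert! (e1.pow (m + 1)).div_const ((m + 1).factorial : ℝ) using 1
      rw [Nat.factorial_succ]
      have : (m.factorial : ℝ) ≠ 0 := by positivity
      have h2 : ((m : ℝ) + 1) ≠ 0 := by positivity
      push_cast
      generalize Real.exp (-(y / 3)) = e
      field_simp
      ring

lemma U_unique (τ : ℕ → ℝ) (m : ℕ) (a : ℕ → ℝ)
    (h : ∀ k < m, ∑ i ∈ Finset.range (m + 1), a i * τ i ^ k = 0) :
    ∃ c, ∀ y, ∑ i ∈ Finset.range (m + 1), a i * Real.exp (τ i * y) = c * U τ m y := by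
  induction m generalizing a with
  | zero => exact ⟨a 0, fun y => by simp [U]⟩
  | succ m ih =>
    have hD : ∀ k, ∑ i ∈ Finset.range (m + 1), a i * (τ i - τ (m + 1)) * τ i ^ k
      = (∑ i ∈ Finset.range (m + 1 + 1), a i * τ i ^ (k + 1))
        - τ (m + 1) * ∑ i ∈ Finset.range (m + 1 + 1), a i * τ i ^ k := by
      intro k
      rw [Finset.sum_range_succ _ (m + 1), Finset.sum_range_succ _ (m + 1), mul_add,
        Finset.mul_sum, add_sub_add_comm, ← Finset.sum_sub_distrib]
      rw [show a (m+1) * τ (m+1) ^ (k+1) - τ (m+1) * (a (m+1) * τ (m+1) ^ k) = 0 by ring, add_zero]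
      apply Finset.sum_congr rfl
      intro i _
      ring
    obtain ⟨c, hc⟩ := ih (fun i => a i * (τ i - τ (m + 1))) (by
      intro k hk
      rw [hD, h (k + 1) (by omega), h k (by omega)]
      ring)
    refine ⟨c, fun y => ?_⟩
    have hU := U_cont τ m
    have := duhamel (G := fun y => ∑ i ∈ Finset.range (m + 1 + 1), a i * Real.exp (τ i * y))
      (g := fun y => c * U τ m y) (τ := τ (m + 1)) (by simpa using h 0 (by omega)) (by fun_prop) (by
        intro y
        have hd : HasDerivAt (fun y => ∑ i ∈ Finset.range (m + 1 + 1), a i * Real.exp (τ i * y))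
          (∑ i ∈ Finset.range (m + 1 + 1), a i * (Real.exp (τ i * y) * (τ i * 1))) y :=
          HasDerivAt.fun_sum fun i _ => (((hasDerivAt_id y).const_mul (τ i)).exp).const_mul (a i)
        convert! hd using 1
        rw [← hc, Finset.sum_range_succ _ (m + 1), Finset.sum_range_succ _ (m + 1), mul_add,
          Finset.mul_sum, add_right_comm, ← Finset.sum_add_distrib]
        congr 1
        · apply Finset.sum_congr rfl
          intro i _
          ring
        · ring) y
    rw [this]
    simp only [U]
    rw [← intervalIntegral.integral_const_mul]
    congr 1
    ext x
    ring

/-- vanishing order gives vanishing power sums -/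
lemma moments_of_bigO (τ : ℕ → ℝ) (N m : ℕ) (a : ℕ → ℝ)
    (h : (fun y : ℝ => ∑ i ∈ Finset.range N, a i * Real.exp (τ i * y)) =O[𝓝[>] 0]
      fun y => y ^ m) :
    ∀ k < m, ∑ i ∈ Finset.range N, a i * τ i ^ k = 0 := by
  intro k
  induction k using Nat.strong_induction_on with
  | _ k ih =>
  intro hk
  have hexp : ∀ t : ℝ, (fun y : ℝ => Real.exp (t * y) - ∑ j ∈ Finset.range (k + 1),
      (t * y) ^ j / j.factorial) =O[𝓝[>] 0] fun y => y ^ (k + 1) := by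
    intro t
    have h1 := (Real.exp_sub_sum_range_isBigO_pow (k + 1)).comp_tendsto
      (k := fun y : ℝ => t * y) (l' := 𝓝[>] 0) (by
        have : Tendsto (fun y : ℝ => t * y) (𝓝 0) (𝓝 (t * 0)) := by
          exact (continuous_const_mul t).tendsto 0
        rw [mul_zero] at this
        exact this.mono_left nhdsWithin_le_nhds)
    refine h1.trans ?_
    refine IsBigO.of_bound (‖t ^ (k+1)‖) (Eventually.of_forall fun y => ?_)
    simp [mul_pow]
  have hsum : (fun y : ℝ => ∑ i ∈ Finset.range N, a i * (Real.exp (τ i * y) -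
      ∑ j ∈ Finset.range (k + 1), (τ i * y) ^ j / j.factorial)) =O[𝓝[>] 0] fun y => y ^ (k + 1) := by
    apply IsBigO.fun_sum
    intro i _
    exact (hexp (τ i)).const_mul_left _
  have heq : ∀ y : ℝ, ∑ i ∈ Finset.range N, a i * (Real.exp (τ i * y) -
      ∑ j ∈ Finset.range (k + 1), (τ i * y) ^ j / j.factorial)
      = (∑ i ∈ Finset.range N, a i * Real.exp (τ i * y))
        - (∑ i ∈ Finset.range N, a i * τ i ^ k) / k.factorial * y ^ k := by
    intro y
    simp_rw [mul_sub]
    rw [Finset.sum_sub_distrib]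
    congr 1
    simp_rw [Finset.mul_sum]
    rw [Finset.sum_comm, Finset.sum_range_succ]
    have h0 : ∑ j ∈ Finset.range k, ∑ i ∈ Finset.range N, a i * ((τ i * y) ^ j / j.factorial) = 0 := by
      apply Finset.sum_eq_zero
      intro j hj
      have hj' := Finset.mem_range.1 hj
      have := ih j hj' (by omega)
      calc ∑ i ∈ Finset.range N, a i * ((τ i * y) ^ j / j.factorial)
          = (∑ i ∈ Finset.range N, a i * τ i ^ j) * (y ^ j / j.factorial) := by
            rw [Finset.sum_mul]
            exact Finset.sum_congr rfl fun i _ => by rw [mul_pow]; ring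
        _ = 0 := by rw [this, zero_mul]
    rw [h0, zero_add, Finset.sum_div, Finset.sum_mul]
    exact Finset.sum_congr rfl fun i _ => by rw [mul_pow]; ring
  simp_rw [heq] at hsum
  have h2 : (fun y : ℝ => y ^ m) =O[𝓝[>] 0] fun y : ℝ => y ^ (k + 1) := by
    refine IsBigO.of_bound 1 ?_
    filter_upwards [Ioo_mem_nhdsGT (show (0:ℝ) < 1 by norm_num)] with y hy
    rw [norm_pow, norm_pow, one_mul, Real.norm_of_nonneg hy.1.le]
    exact pow_le_pow_of_le_one hy.1.le hy.2.le (by omega)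
  have h3 := (h.trans h2).sub hsum
  simp only [sub_sub_cancel] at h3
  set M := (∑ i ∈ Finset.range N, a i * τ i ^ k)
  have h4 : (fun _ : ℝ => M / k.factorial) =O[𝓝[>] 0] fun y : ℝ => y := by
    obtain ⟨C, hC⟩ := h3.bound
    refine IsBigO.of_bound C ?_
    filter_upwards [hC, self_mem_nhdsWithin] with y hy hy0
    have hy0 : 0 < y := hy0
    rw [norm_mul, norm_pow, norm_pow, pow_succ] at hy
    have : 0 < ‖y‖ ^ k := by have := norm_pos_iff.2 hy0.ne'; positivity
    exact le_of_mul_le_mul_right (by linarith) this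
  have h5 : Tendsto (fun _ : ℝ => M / k.factorial) (𝓝[>] 0) (𝓝 0) :=
    h4.trans_tendsto (tendsto_id.mono_left nhdsWithin_le_nhds)
  have h6 := tendsto_nhds_unique h5 tendsto_const_nhds
  have : (k.factorial : ℝ) ≠ 0 := by positivity
  field_simp at h6
  linarith

end HP

namespace HP

lemma lam_eq {x : ℝ} (hx : x ∈ Set.Ioo (-1 : ℝ) 1) : lambdaDensity x =
    Real.sqrt 3 / (4 * Real.pi) * (W (-(2/3)) x / (1 + x) + W (-(1/3)) x / (1 + x)) := by
  have h1 : 0 < 1 - x := by linarith [hx.2]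
  have h2 : 0 < 1 + x := by linarith [hx.1]
  unfold lambdaDensity W
  rw [mul_assoc]
  congr 1
  have e : (1 - x ^ 2) = (1 - x) * (1 + x) := by ring
  rw [e, Real.mul_rpow h1.le h2.le, Real.div_rpow h1.le h2.le, Real.div_rpow h1.le h2.le, mul_add]
  congr 1
  · have e1 : (1 - x) ^ (-(2/3) : ℝ) = (1 - x) ^ (-(1/3) : ℝ) * (1 - x) ^ (-(1/3) : ℝ) := by
      rw [← Real.rpow_add h1]; norm_num
    have e2 : (1 + x) ^ (-(2/3) : ℝ) * (1 + x) * (1 + x) ^ (-(1/3) : ℝ) = 1 := by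
      nth_rewrite 2 [← Real.rpow_one (1 + x)]
      rw [← Real.rpow_add h2, ← Real.rpow_add h2]; norm_num
    rw [e1, div_div, eq_div_iff (by positivity)]
    linear_combination (1 - x) ^ (-(1/3) : ℝ) * (1 - x) ^ (-(1/3) : ℝ) * e2
  · have e2 : (1 + x) ^ (-(1/3) : ℝ) * (1 + x) * ((1 + x) ^ (-(1/3) : ℝ) * (1 + x) ^ (-(1/3) : ℝ)) = 1 := by
      nth_rewrite 2 [← Real.rpow_one (1 + x)]
      rw [← Real.rpow_add h2, ← Real.rpow_add h2, ← Real.rpow_add h2]; norm_num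
    rw [div_div, eq_div_iff (by positivity)]
    linear_combination (1 - x) ^ (-(1/3) : ℝ) * e2

lemma sin13 : Real.sin (Real.pi * (-(1/3))) = - (Real.sqrt 3 / 2) := by
  rw [show Real.pi * (-(1/3)) = -(Real.pi / 3) by ring, Real.sin_neg, Real.sin_pi_div_three]

lemma sin23 : Real.sin (Real.pi * (-(2/3))) = - (Real.sqrt 3 / 2) := by
  rw [show Real.pi * (-(2/3)) = -(Real.pi - Real.pi / 3) by ring, Real.sin_neg, Real.sin_pi_sub,
    Real.sin_pi_div_three]

lemma lam_integrable : IntegrableOn lambdaDensity (Set.Ioo (-1) 1) := by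
  have := ((Wd_integrable (β := -(2/3)) (by norm_num) (by norm_num)).add
    (Wd_integrable (β := -(1/3)) (by norm_num) (by norm_num))).const_mul (Real.sqrt 3 / (4 * Real.pi))
  refine IntegrableOn.congr_fun (f := fun x => Real.sqrt 3 / (4 * Real.pi) *
    (W (-(2/3)) x / (1 + x) + W (-(1/3)) x / (1 + x))) this ?_ measurableSet_Ioo
  intro x hx
  exact (lam_eq hx).symm

lemma lam_pos {x : ℝ} (hx : x ∈ Set.Ioo (-1 : ℝ) 1) : 0 < lambdaDensity x := by
  rw [lam_eq hx]
  have h2 : 0 < 1 + x := by linarith [hx.1]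
  have := W_pos (β := -(2/3)) hx
  have := W_pos (β := -(1/3)) hx
  have := Real.pi_pos
  positivity

lemma lam_integral : ∫ x in Set.Ioo (-1 : ℝ) 1, lambdaDensity x = 1 := by
  rw [setIntegral_congr_fun measurableSet_Ioo (fun x hx => lam_eq hx), integral_const_mul,
    integral_add (Wd_integrable (by norm_num) (by norm_num)) (Wd_integrable (by norm_num) (by norm_num)),
    Wd_integral (by norm_num) (by norm_num), Wd_integral (by norm_num) (by norm_num), sin13, sin23]
  have := Real.pi_pos
  have h3 : Real.sqrt 3 > 0 := by positivity
  field_simp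
  norm_num

lemma lam_cauchy {v : ℝ} (hv : 0 < v) (hv1 : v < 1) :
    ∫ x in Set.Ioo (-1 : ℝ) 1, lambdaDensity x / ((1 + v) / (1 - v) - x)
      = (1 - v) / 4 * (v ^ (-(2/3) : ℝ) + v ^ (-(1/3) : ℝ)) := by
  have : Set.EqOn (fun x => lambdaDensity x / ((1 + v) / (1 - v) - x))
    (fun x => Real.sqrt 3 / (4 * Real.pi) * (W (-(2/3)) x / (1 + x) / ((1 + v) / (1 - v) - x)
      + W (-(1/3)) x / (1 + x) / ((1 + v) / (1 - v) - x))) (Set.Ioo (-1) 1) := by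
    intro x hx
    simp only
    rw [lam_eq hx]; ring
  rw [setIntegral_congr_fun measurableSet_Ioo this, integral_const_mul,
    integral_add (Wdz_integrable (by norm_num) (by norm_num) hv hv1)
      (Wdz_integrable (by norm_num) (by norm_num) hv hv1),
    Wdz_integral (by norm_num) (by norm_num) hv hv1, Wdz_integral (by norm_num) (by norm_num) hv hv1,
    sin13, sin23]
  have := Real.pi_pos
  have h3 : Real.sqrt 3 > 0 := by positivity
  field_simp

lemma lam_mul_integrable {g : ℝ → ℝ} (hg : ContinuousOn g (Set.Icc (-1) 1)) :
    IntegrableOn (fun x => g x * lambdaDensity x) (Set.Ioo (-1) 1) := by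
  obtain ⟨C, hC⟩ := isCompact_Icc.exists_bound_of_continuousOn hg
  refine Integrable.bdd_mul (c := C) lam_integrable
    ((hg.mono Set.Ioo_subset_Icc_self).aestronglyMeasurable measurableSet_Ioo) ?_
  exact ae_restrict_of_forall_mem measurableSet_Ioo fun x hx => hC x (Set.Ioo_subset_Icc_self hx)

noncomputable def pot (t : ℝ) : ℝ := ∫ x in Set.Ioo (-1 : ℝ) 1, Real.log (1 - x * t) * lambdaDensity x

lemma one_sub_pos {x t : ℝ} (hx : |x| ≤ 1) (ht : |t| < 1) : 0 < 1 - x * t := by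
  have : |x * t| < 1 := by
    rw [abs_mul]
    calc |x| * |t| ≤ 1 * |t| := by gcongr
      _ < 1 := by linarith
  linarith [(abs_lt.1 this).2]

lemma log_cont {t : ℝ} (ht : |t| < 1) :
    ContinuousOn (fun x => Real.log (1 - x * t)) (Set.Icc (-1) 1) := by
  apply ContinuousOn.log (by fun_prop)
  intro x hx
  exact (one_sub_pos (abs_le.2 hx) ht).ne'

lemma pot_deriv {t : ℝ} (ht : |t| < 1) : HasDerivAt pot
    (∫ x in Set.Ioo (-1 : ℝ) 1, (-x / (1 - x * t)) * lambdaDensity x) t := by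
  set ε := (1 - |t|) / 2 with hε
  have hε0 : 0 < ε := by rw [hε]; linarith
  have hb : ∀ s ∈ Metric.ball t ε, |s| < 1 - ε := by
    intro s hs
    rw [Metric.mem_ball, Real.dist_eq] at hs
    have : |s| ≤ |s - t| + |t| := by simpa using abs_add_le (s - t) t
    rw [hε] at *
    linarith
  refine (hasDerivAt_integral_of_dominated_loc_of_deriv_le (μ := volume.restrict (Set.Ioo (-1:ℝ) 1))
    (F := fun t x => Real.log (1 - x * t) * lambdaDensity x)
    (F' := fun t x => (-x / (1 - x * t)) * lambdaDensity x)
    (bound := fun x => 1 / ε * lambdaDensity x)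
    (Metric.ball_mem_nhds t hε0) ?_ ?_ ?_ ?_ ?_ ?_).2
  · filter_upwards [Metric.ball_mem_nhds t hε0] with s hs
    exact (lam_mul_integrable (log_cont (by linarith [hb s hs]))).aestronglyMeasurable
  · exact lam_mul_integrable (log_cont ht)
  · refine (lam_mul_integrable (g := fun x => -x / (1 - x * t)) ?_).aestronglyMeasurable
    apply ContinuousOn.div (by fun_prop) (by fun_prop)
    intro x hx
    exact (one_sub_pos (abs_le.2 hx) ht).ne'
  · refine ae_restrict_of_forall_mem measurableSet_Ioo fun x hx s hs => ?_
    have hl := lam_pos hx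
    have hx' : |x| ≤ 1 := abs_le.2 ⟨hx.1.le, hx.2.le⟩
    have hs' := hb s hs
    have h1 : ε < 1 - x * s := by
      have : x * s ≤ |x| * |s| := by rw [← abs_mul]; exact le_abs_self _
      have : |x| * |s| ≤ 1 * |s| := by gcongr
      linarith
    rw [norm_mul, Real.norm_of_nonneg hl.le, norm_div, norm_neg, Real.norm_eq_abs,
      Real.norm_of_nonneg (by linarith)]
    gcongr
  · exact lam_integrable.const_mul _
  · refine ae_restrict_of_forall_mem measurableSet_Ioo fun x hx s hs => ?_
    have hx' : |x| ≤ 1 := abs_le.2 ⟨hx.1.le, hx.2.le⟩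
    have hs' := hb s hs
    have h1 := one_sub_pos hx' (by linarith : |s| < 1)
    have : HasDerivAt (fun s => 1 - x * s) (-(x * 1)) s := ((hasDerivAt_id s).const_mul x).const_sub 1
    have := (this.log h1.ne').mul_const (lambdaDensity x)
    simpa using this

noncomputable def Lf (t : ℝ) : ℝ := Real.log (1 + t) + 3 / 2 *
  Real.log ((1 + ((1 - t) / (1 + t)) ^ (1/3 : ℝ) + (((1 - t) / (1 + t)) ^ (1/3 : ℝ)) ^ 2) / 3)

lemma pot_eq {t : ℝ} (ht0 : 0 < t) (ht1 : t < 1) : pot t = Lf t := by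
  have hd : ∀ s ∈ Set.Ioo 0 t, HasDerivAt (fun s => pot s - Lf s) 0 s := by
    intro s hs
    have hs0 : 0 < s := hs.1
    have hs1 : s < 1 := hs.2.trans ht1
    have h1 := pot_deriv (t := s) (by rw [abs_of_pos hs0]; exact hs1)
    set v := (1 - s) / (1 + s) with hv
    have hv0 : 0 < v := div_pos (by linarith) (by linarith)
    have hv1 : v < 1 := by rw [hv, div_lt_one (by linarith)]; linarith
    set r := v ^ (1/3 : ℝ) with hr
    have hr0 : 0 < r := Real.rpow_pos_of_pos hv0 _
    have hr3 : r ^ 3 = v := by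
      rw [hr, ← Real.rpow_natCast, ← Real.rpow_mul hv0.le]; norm_num
    have hr1 : v ^ (-(1/3) : ℝ) = 1 / r := by
      rw [Real.rpow_neg hv0.le, ← hr, one_div r]
    have hr2 : v ^ (-(2/3) : ℝ) = 1 / r ^ 2 := by
      rw [hr, ← Real.rpow_natCast, ← Real.rpow_mul hv0.le, one_div, ← Real.rpow_neg hv0.le]; norm_num
    have hz : (1 + v) / (1 - v) = 1 / s := by
      have q1 : 1 + v = 2 / (1 + s) := by rw [hv]; field_simp; ring
      have q2 : 1 - v = 2 * s / (1 + s) := by rw [hv]; field_simp; ring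
      rw [q1, q2]; field_simp
    have hint : ∫ x in Set.Ioo (-1 : ℝ) 1, (-x / (1 - x * s)) * lambdaDensity x
        = 1 / s - 1 / s ^ 2 * ((1 - v) / 4 * (1 / r ^ 2 + 1 / r)) := by
      have : Set.EqOn (fun x => (-x / (1 - x * s)) * lambdaDensity x)
          (fun x => 1 / s * lambdaDensity x - 1 / s ^ 2 * (lambdaDensity x / ((1 + v) / (1 - v) - x)))
          (Set.Ioo (-1) 1) := by
        intro x hx
        have h3 := one_sub_pos (abs_le.2 ⟨hx.1.le, hx.2.le⟩) (by rw [abs_of_pos hs0]; exact hs1 : |s| < 1)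
        simp only
        rw [hz]
        have : 1 / s - x = (1 - x * s) / s := by field_simp
        rw [this]
        generalize lambdaDensity x = l
        generalize hd : 1 - x * s = d at *
        field_simp
        linear_combination l * hd
      rw [setIntegral_congr_fun measurableSet_Ioo this, integral_sub (lam_integrable.const_mul _),
        integral_const_mul, integral_const_mul, lam_integral, lam_cauchy hv0 hv1, hr1, hr2, mul_one]
      apply Integrable.const_mul
      have := lam_mul_integrable (g := fun x => 1 / ((1 + v) / (1 - v) - x)) (by
        apply ContinuousOn.div (by fun_prop) (by fun_prop)
        intro x hx
        have : 1 < 1 / s := by rw [lt_div_iff₀ hs0]; linarith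
        rw [hz]
        have := hx.2
        linarith)
      refine this.congr_fun ?_ measurableSet_Ioo
      intro x _
      simp only
      ring
    rw [hint] at h1
    have e1 : HasDerivAt (fun s : ℝ => (1 - s) / (1 + s)) (-2 / (1 + s) ^ 2) s := by
      convert! ((hasDerivAt_id s).const_sub 1).div ((hasDerivAt_id s).const_add 1)
        (by simp only [id]; linarith : 1 + id s ≠ 0) using 1
      simp only [id]
      ring
    have e2 : HasDerivAt (fun s : ℝ => ((1 - s) / (1 + s)) ^ (1/3 : ℝ))
        (-2 / (1 + s) ^ 2 * (1/3) * (1 / r ^ 2)) s := by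
      convert! e1.rpow_const (p := 1/3) (Or.inl hv0.ne') using 1
      rw [← hr2]; norm_num
      exact Or.inl rfl
    have e3 := ((e2.const_add 1).add (e2.pow 2)).div_const 3
    have e4 := (e3.log (by
      simp only [Pi.add_apply, Pi.pow_apply]
      have : 0 < (1 + r + r ^ 2) / 3 := by positivity
      exact this.ne')).const_mul (3/2)
    have e5 := (((hasDerivAt_id s).const_add 1).log (by simp only [id]; linarith : 1 + id s ≠ 0)).add e4
    have e6 := h1.sub e5
    convert! e6 using 1
    simp only [Pi.add_apply, Pi.pow_apply, id]
    have hs' : s = (1 - r ^ 3) / (1 + r ^ 3) := by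
      rw [hr3, hv]; field_simp; ring
    rw [← hr3]
    simp only [show ((1 - s) / (1 + s)) ^ (1/3 : ℝ) = r from rfl]
    have hrlt : r < 1 := by
      by_contra hcon
      push Not at hcon
      have := one_le_pow₀ (n := 3) hcon
      linarith
    have hne : 1 - r ^ 3 ≠ 0 := by rw [hr3]; linarith
    have hs2 : 1 + s = 2 / (1 + r ^ 3) := by
      rw [hs']; field_simp; ring
    rw [hs2, hs']
    have hrm : 1 - r ^ 3 = (1 - r) * (1 + r + r ^ 2) := by ring
    have : 1 - r ≠ 0 := by linarith
    rw [hrm]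
    field_simp
    ring
  have hc : ContinuousOn (fun s => pot s - Lf s) (Set.Icc 0 t) := by
    apply ContinuousOn.sub
    · intro s hs
      exact (pot_deriv (by rw [abs_of_nonneg hs.1]; linarith [hs.2])).continuousAt.continuousWithinAt
    · unfold Lf
      have h1 : ContinuousOn (fun s : ℝ => ((1 - s) / (1 + s)) ^ (1/3 : ℝ)) (Set.Icc 0 t) := by
        apply ContinuousOn.rpow_const
        · apply ContinuousOn.div (by fun_prop) (by fun_prop)
          intro s hs; linarith [hs.1]
        · intro s hs; right; norm_num
      apply ContinuousOn.add
      · apply ContinuousOn.log (by fun_prop)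
        intro s hs; linarith [hs.1]
      · apply ContinuousOn.mul continuousOn_const
        apply ContinuousOn.log (by fun_prop)
        intro s hs
        have : 0 ≤ ((1 - s) / (1 + s)) ^ (1/3 : ℝ) :=
          Real.rpow_nonneg (div_nonneg (by linarith [hs.2]) (by linarith [hs.1])) _
        positivity
  obtain ⟨c, -, hcc⟩ := exists_hasDerivAt_eq_slope (fun s => pot s - Lf s) (fun _ => 0) ht0 hc hd
  rw [eq_comm, div_eq_zero_iff] at hcc
  rcases hcc with h | h
  · have h0 : pot 0 - Lf 0 = 0 := by
      simp [pot, Lf]; norm_num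
    linarith
  · linarith

end HP

namespace HP

noncomputable def En (Z : ℕ → Finset ℂ) (m : ℕ → ℂ → ℕ) (n : ℕ) (g : ℝ → ℝ) : ℝ :=
  1 / (2 * (n : ℝ)) * ∑ x ∈ Z n, (m n x : ℝ) * g x.re
    - ∫ x in Set.Ioo (-1 : ℝ) 1, g x * lambdaDensity x

lemma En_add (Z : ℕ → Finset ℂ) (m : ℕ → ℂ → ℕ) (n : ℕ) {g h : ℝ → ℝ}
    (hg : ContinuousOn g (Set.Icc (-1) 1)) (hh : ContinuousOn h (Set.Icc (-1) 1)) :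
    En Z m n (fun x => g x + h x) = En Z m n g + En Z m n h := by
  unfold En
  simp only [mul_add, add_mul, Finset.sum_add_distrib]
  rw [integral_add (lam_mul_integrable hg) (lam_mul_integrable hh)]
  ring

lemma En_smul (Z : ℕ → Finset ℂ) (m : ℕ → ℂ → ℕ) (n : ℕ) (c : ℝ) (g : ℝ → ℝ) :
    En Z m n (fun x => c * g x) = c * En Z m n g := by
  unfold En
  simp only [mul_assoc, integral_const_mul, mul_sub, Finset.mul_sum]
  congr 1
  apply Finset.sum_congr rfl
  intro x _
  ring

lemma En_sum (Z : ℕ → Finset ℂ) (m : ℕ → ℂ → ℕ) (n : ℕ) (g : ℕ → ℝ → ℝ)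
    (hg : ∀ i, ContinuousOn (g i) (Set.Icc (-1) 1)) (K : ℕ) :
    En Z m n (fun x => ∑ i ∈ Finset.range K, g i x) = ∑ i ∈ Finset.range K, En Z m n (g i) := by
  induction K with
  | zero => simp [En]
  | succ K ih =>
    simp only [Finset.sum_range_succ]
    rw [En_add Z m n (continuousOn_finsetSum _ fun i _ => hg i) (hg K), ih]

lemma En_bound {Z : ℕ → Finset ℂ} {m : ℕ → ℂ → ℕ}
    (hreal : ∀ n, ∀ x ∈ Z n, x.im = 0 ∧ |x.re| < 1)
    (hsum : ∀ n, ∑ x ∈ Z n, m n x = 2 * n + 1) {n : ℕ} (hn : 1 ≤ n) {g : ℝ → ℝ} {ε : ℝ}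
    (hb : ∀ x ∈ Set.Icc (-1 : ℝ) 1, |g x| ≤ ε) : |En Z m n g| ≤ 5 / 2 * ε := by
  have hn' : (1 : ℝ) ≤ n := by exact_mod_cast hn
  have hε : 0 ≤ ε := (abs_nonneg _).trans (hb 0 (by norm_num))
  unfold En
  have h1 : |1 / (2 * (n : ℝ)) * ∑ x ∈ Z n, (m n x : ℝ) * g x.re| ≤ 3 / 2 * ε := by
    rw [abs_mul, abs_of_nonneg (by positivity)]
    have : |∑ x ∈ Z n, (m n x : ℝ) * g x.re| ≤ (2 * n + 1) * ε := by
      calc _ ≤ ∑ x ∈ Z n, |(m n x : ℝ) * g x.re| := Finset.abs_sum_le_sum_abs _ _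
        _ ≤ ∑ x ∈ Z n, (m n x : ℝ) * ε := by
          apply Finset.sum_le_sum
          intro x hx
          rw [abs_mul, Nat.abs_cast]
          gcongr
          exact hb _ (abs_le.1 (hreal n x hx).2.le)
        _ = _ := by
          rw [← Finset.sum_mul, ← Nat.cast_sum, hsum]; push_cast; ring
    calc _ ≤ 1 / (2 * (n : ℝ)) * ((2 * n + 1) * ε) := by gcongr
      _ = (1 + 1 / (2 * n)) * ε := by field_simp
      _ ≤ _ := by
        gcongr
        have : 1 / (2 * (n : ℝ)) ≤ 1 / 2 := by
          rw [div_le_div_iff₀ (by positivity) (by positivity)]; linarith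
        linarith
  have h2 : |∫ x in Set.Ioo (-1 : ℝ) 1, g x * lambdaDensity x| ≤ ε := by
    rw [← Real.norm_eq_abs]
    calc _ ≤ ∫ x in Set.Ioo (-1 : ℝ) 1, ε * lambdaDensity x := by
          apply norm_integral_le_of_norm_le (lam_integrable.const_mul ε)
          refine ae_restrict_of_forall_mem measurableSet_Ioo fun x hx => ?_
          rw [norm_mul, Real.norm_of_nonneg (lam_pos hx).le]
          have := (lam_pos hx).le
          gcongr
          exact hb x (Set.Ioo_subset_Icc_self hx)
      _ = ε := by rw [integral_const_mul, lam_integral, mul_one]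
  rw [abs_le] at *
  constructor <;> linarith [h1.1, h1.2, h2.1, h2.2]

lemma En_moment {Z : ℕ → Finset ℂ} {m : ℕ → ℂ → ℕ}
    (hreal : ∀ n, ∀ x ∈ Z n, x.im = 0 ∧ |x.re| < 1)
    (hsum : ∀ n, ∑ x ∈ Z n, m n x = 2 * n + 1)
    (hlog : ∀ t : ℝ, 0 < t → t < 1 → Tendsto (fun n : ℕ => 1 / (2 * (n : ℝ)) *
      ∑ x ∈ Z n, (m n x : ℝ) * Real.log (1 - x.re * t)) atTop (𝓝 (pot t))) (k : ℕ) :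
    Tendsto (fun n => En Z m n (fun x => x ^ k)) atTop (𝓝 0) := by
  induction k using Nat.strong_induction_on with
  | _ k ih =>
  rcases k with _ | k
  · have : ∀ᶠ n : ℕ in atTop, 1 / 2 * (1 / (n : ℝ)) = En Z m n (fun x => x ^ 0) := by
      filter_upwards [eventually_ge_atTop 1] with n hn
      have hn' : (1 : ℝ) ≤ n := by exact_mod_cast hn
      unfold En
      simp only [pow_zero, mul_one, one_mul, lam_integral]
      rw [← Nat.cast_sum, hsum]; push_cast
      field_simp
      ring
    refine Tendsto.congr' this ?_
    have h := (tendsto_one_div_atTop_nhds_zero_nat (𝕜 := ℝ)).const_mul (1/2)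
    rwa [mul_zero] at h
  · rw [Metric.tendsto_atTop]
    intro ε hε
    obtain ⟨t, ht0, ht1, ht2⟩ : ∃ t : ℝ, 0 < t ∧ t ≤ 1 / 2 ∧ (k + 1) * (5 * t) < ε / 2 := by
      refine ⟨min (1/2) (ε / (20 * (k + 1))), by positivity, min_le_left _ _, ?_⟩
      have := min_le_right (1/2) (ε / (20 * ((k : ℝ) + 1)))
      calc ((k : ℝ) + 1) * (5 * min (1/2) (ε / (20 * (k + 1))))
          ≤ (k + 1) * (5 * (ε / (20 * (k + 1)))) := by gcongr
        _ = ε / 4 := by field_simp; norm_num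
        _ < _ := by linarith
    have htl : |t| < 1 := by rw [abs_of_pos ht0]; linarith
    set A : ℕ → ℝ := fun n => En Z m n (fun x => Real.log (1 - x * t)) +
      ∑ i ∈ Finset.range k, t ^ (i + 1) / (i + 1) * En Z m n (fun x => x ^ (i + 1)) with hA
    have hA0 : Tendsto A atTop (𝓝 0) := by
      have h1 : Tendsto (fun n => En Z m n (fun x => Real.log (1 - x * t))) atTop (𝓝 0) := by
        have := (hlog t ht0 (by linarith)).sub_const (pot t)
        simpa [En, pot] using this
      have h2 : Tendsto (fun n => ∑ i ∈ Finset.range k, t ^ (i + 1) / ((i : ℝ) + 1) *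
          En Z m n (fun x => x ^ (i + 1))) atTop (𝓝 (∑ i ∈ Finset.range k, 0)) := by
        apply tendsto_finsetSum
        intro i hi
        have := (ih (i + 1) (by simpa using hi)).const_mul (t ^ (i + 1) / ((i : ℝ) + 1))
        simpa using this
      simpa [hA] using h1.add h2
    have key : ∀ n ≥ 1, |A n + t ^ (k + 1) / (k + 1) * En Z m n (fun x => x ^ (k + 1))|
        ≤ 5 / 2 * (t ^ (k + 2) / (1 - t)) := by
      intro n hn
      have e : A n + t ^ (k + 1) / (k + 1) * En Z m n (fun x => x ^ (k + 1)) =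
          En Z m n (fun x => Real.log (1 - x * t) +
            ∑ i ∈ Finset.range (k + 1), t ^ (i + 1) / ((i : ℝ) + 1) * x ^ (i + 1)) := by
        rw [En_add Z m n (log_cont htl) (by fun_prop),
          En_sum Z m n (fun i x => t ^ (i + 1) / ((i : ℝ) + 1) * x ^ (i + 1)) (by intro i; fun_prop)]
        simp only [En_smul]
        rw [Finset.sum_range_succ, hA]; simp only; ring
      rw [e]
      apply En_bound hreal hsum hn
      intro x hx
      have hx1 : |x| ≤ 1 := abs_le.2 hx
      have hxt : |x * t| ≤ t := by
        rw [abs_mul, abs_of_pos ht0]; nlinarith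
      have := Real.abs_log_sub_add_sum_range_le (x := x * t) (by linarith) (k + 1)
      rw [add_comm]
      calc _ = |∑ i ∈ Finset.range (k + 1), (x * t) ^ (i + 1) / ((i : ℝ) + 1) + Real.log (1 - x * t)| := by
            congr 2
            apply Finset.sum_congr rfl
            intro i _
            rw [mul_pow]; ring
        _ ≤ _ := this
        _ ≤ _ := by
          have : (0:ℝ) < 1 - t := by linarith
          gcongr
    have hδ : 0 < t ^ (k + 1) / (k + 1) * (ε / 2) := by positivity
    obtain ⟨N, hN⟩ := Metric.tendsto_atTop.1 hA0 _ hδ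
    refine ⟨max N 1, fun n hn => ?_⟩
    have h1 := hN n (le_of_max_le_left hn)
    have h2 := key n (le_of_max_le_right hn)
    rw [Real.dist_eq, sub_zero] at h1 ⊢
    set e := En Z m n (fun x => x ^ (k + 1)) with he
    have h3 : t ^ (k + 1) / (k + 1) * |e| ≤ |A n| + 5 / 2 * (t ^ (k + 2) / (1 - t)) := by
      rw [show t ^ (k + 1) / (k + 1) * |e| = |t ^ (k + 1) / (k + 1) * e| by
        rw [abs_mul, abs_of_pos (by positivity : 0 < t ^ (k + 1) / ((k : ℝ) + 1))]]
      have := abs_sub_abs_le_abs_sub (t ^ (k + 1) / (k + 1) * e) (-A n)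
      rw [abs_neg, sub_neg_eq_add, add_comm _ (A n)] at this
      linarith
    have h4 : 5 / 2 * (t ^ (k + 2) / (1 - t)) ≤ t ^ (k + 1) / (k + 1) * ((k + 1) * (5 * t)) := by
      have : t ^ (k + 2) / (1 - t) ≤ t ^ (k + 2) / (1 / 2) := by
        gcongr
        linarith
      calc _ ≤ 5 / 2 * (t ^ (k + 2) / (1 / 2)) := by gcongr
        _ = _ := by field_simp; ring
    have h5 : t ^ (k + 1) / (k + 1) * ((k + 1) * (5 * t)) < t ^ (k + 1) / (k + 1) * (ε / 2) := by
      gcongr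
    have h6 : t ^ (k + 1) / (k + 1) * |e| < t ^ (k + 1) / (k + 1) * ε := by
      calc _ < t ^ (k + 1) / (k + 1) * (ε / 2) + t ^ (k + 1) / (k + 1) * (ε / 2) := by linarith
        _ = _ := by ring
    exact lt_of_mul_lt_mul_left h6 (by positivity)

lemma weak_conv {Z : ℕ → Finset ℂ} {m : ℕ → ℂ → ℕ}
    (hreal : ∀ n, ∀ x ∈ Z n, x.im = 0 ∧ |x.re| < 1)
    (hsum : ∀ n, ∑ x ∈ Z n, m n x = 2 * n + 1)
    (hlog : ∀ t : ℝ, 0 < t → t < 1 → Tendsto (fun n : ℕ => 1 / (2 * (n : ℝ)) *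
      ∑ x ∈ Z n, (m n x : ℝ) * Real.log (1 - x.re * t)) atTop (𝓝 (pot t)))
    (φ : ℂ → ℝ) (hφ : Continuous φ) :
    Tendsto (fun n : ℕ => (1 / (2 * (n : ℝ))) * ∑ x ∈ Z n, (m n x : ℝ) * φ x)
        atTop (𝓝 (∫ x in Set.Ioo (-1 : ℝ) 1, φ (x : ℂ) * lambdaDensity x)) := by
  have hp : ∀ p : ℝ[X], Tendsto (fun n => En Z m n (fun x => p.eval x)) atTop (𝓝 0) := by
    intro p
    have : ∀ n, En Z m n (fun x => p.eval x) =
        ∑ i ∈ Finset.range (p.natDegree + 1), p.coeff i * En Z m n (fun x => x ^ i) := by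
      intro n
      simp only [Polynomial.eval_eq_sum_range]
      rw [En_sum Z m n (fun i x => p.coeff i * x ^ i) (by intro i; fun_prop)]
      simp only [En_smul]
    simp only [this]
    rw [show (0 : ℝ) = ∑ i ∈ Finset.range (p.natDegree + 1), 0 by simp]
    apply tendsto_finsetSum
    intro i _
    simpa using (En_moment hreal hsum hlog i).const_mul (p.coeff i)
  set g : ℝ → ℝ := fun x => φ (x : ℂ) with hg
  have hgc : Continuous g := by fun_prop
  have hE : Tendsto (fun n => En Z m n g) atTop (𝓝 0) := by
    rw [Metric.tendsto_atTop]
    intro ε hε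
    obtain ⟨p, hpp⟩ := exists_polynomial_near_of_continuousOn (-1) 1 g hgc.continuousOn (ε / 5)
      (by positivity)
    obtain ⟨N, hN⟩ := Metric.tendsto_atTop.1 (hp p) (ε / 2) (by positivity)
    refine ⟨max N 1, fun n hn => ?_⟩
    have h1 := hN n (le_of_max_le_left hn)
    have h2 := En_bound hreal hsum (le_of_max_le_right hn) (g := fun x => -1 * p.eval x + g x)
      (ε := ε / 5) (by
        intro x hx
        have := hpp x hx
        rw [abs_sub_comm] at this
        have e : -1 * p.eval x + g x = g x - p.eval x := by ring
        rw [e]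
        exact this.le)
    rw [En_add Z m n (by fun_prop) hgc.continuousOn, En_smul] at h2
    rw [Real.dist_eq, sub_zero] at h1 ⊢
    rw [abs_lt] at *
    rw [abs_le] at h2
    constructor <;> linarith [h2.1, h2.2, h1.1, h1.2]
  have := hE.add_const (∫ x in Set.Ioo (-1 : ℝ) 1, g x * lambdaDensity x)
  rw [zero_add] at this
  refine this.congr fun n => ?_
  unfold En
  rw [sub_add_cancel]
  congr 1
  apply Finset.sum_congr rfl
  intro x hx
  rw [hg]
  simp only
  congr 2
  apply Complex.ext <;> simp [(hreal n x hx).1]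

end HP

namespace HP

/-- complement of the two rays -/
def SU : Set ℂ := {z : ℂ | ¬(z.im = 0 ∧ 1 ≤ |z.re|)}
/-- complement of the segment -/
def SV : Set ℂ := {z : ℂ | ¬(z.im = 0 ∧ |z.re| ≤ 1)}

lemma SU_open : IsOpen SU := by
  have : SU = {z : ℂ | z.im = 0 ∧ 1 ≤ |z.re|}ᶜ := rfl
  rw [this, isOpen_compl_iff]
  exact (isClosed_eq Complex.continuous_im continuous_const).inter
    (isClosed_le continuous_const (Complex.continuous_re.abs))

lemma SV_open : IsOpen SV := by
  have : SV = {z : ℂ | z.im = 0 ∧ |z.re| ≤ 1}ᶜ := rfl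
  rw [this, isOpen_compl_iff]
  exact (isClosed_eq Complex.continuous_im continuous_const).inter
    (isClosed_le (Complex.continuous_re.abs) continuous_const)

lemma zero_mem_SU : (0 : ℂ) ∈ SU := by simp [SU]

lemma real_mem_SU {x : ℝ} (hx : x ∈ Set.Ioo (-1 : ℝ) 1) : (x : ℂ) ∈ SU := by
  simp only [SU, Set.mem_ofPred_eq, Complex.ofReal_im, Complex.ofReal_re, true_and, not_le]
  exact abs_lt.2 hx

lemma real_mem_SV {x : ℝ} (hx : 1 < x) : (x : ℂ) ∈ SV := by
  simp only [SV, Set.mem_ofPred_eq, Complex.ofReal_im, Complex.ofReal_re, true_and, not_le]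
  exact lt_of_lt_of_le hx (le_abs_self _)

lemma SU_preconn : IsPreconnected SU := by
  have : StarConvex ℝ (0 : ℂ) SU := by
    intro z hz a b ha hb hab
    simp only [smul_zero, zero_add]
    intro ⟨h1, h2⟩
    simp at h1 h2
    have hb1 : b ≤ 1 := by linarith
    apply hz
    rcases h1 with h | h
    · rw [h] at h2; norm_num at h2
    · refine ⟨h, h2.trans ?_⟩
      rw [abs_of_nonneg hb]
      nlinarith [abs_nonneg z.re]
  exact (this.isPathConnected zero_mem_SU).isConnected.isPreconnected

lemma inv_mem_SU {s : ℂ} (hs : s ∈ SV) : s⁻¹ ∈ SU := by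
  intro ⟨h1, h2⟩
  apply hs
  have h0 : s ≠ 0 := by
    rintro rfl
    simp at h2
    norm_num at h2
  have e : s⁻¹ = ((s⁻¹).re : ℂ) := by
    apply Complex.ext <;> simp [h1]
  have e2 : s = (((s⁻¹).re)⁻¹ : ℝ) := by
    rw [Complex.ofReal_inv, ← e, inv_inv]
  rw [e2]
  simp only [Complex.ofReal_im, Complex.ofReal_re, true_and]
  rw [abs_inv]
  exact inv_le_one_of_one_le₀ h2

lemma ne_zero_SV {s : ℂ} (hs : s ∈ SV) : s ≠ 0 := by
  rintro rfl
  apply hs; simp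

lemma one_sub_ne {z : ℂ} (hz : z ∈ SU) {x : ℝ} (hx : x ∈ Set.Icc (-1 : ℝ) 1) : 1 - (x : ℂ) * z ≠ 0 := by
  intro h
  have hx' : |x| ≤ 1 := abs_le.2 hx
  have h1 := congrArg Complex.re h
  have h2 := congrArg Complex.im h
  simp at h1 h2
  rcases h2 with h2 | h2
  · rw [h2] at h1; norm_num at h1
  · apply hz
    refine ⟨h2, ?_⟩
    have : 1 = |x| * |z.re| := by
      rw [← abs_mul, show x * z.re = 1 by linarith, abs_one]
    nlinarith [abs_nonneg z.re]

/-- the transform -/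
noncomputable def T (g : ℝ → ℝ) (z : ℂ) : ℂ := ∫ x in Set.Ioo (-1 : ℝ) 1, (g x : ℂ) / (1 - x * z)
/-- the Cauchy transform -/
noncomputable def Cc (g : ℝ → ℝ) (s : ℂ) : ℂ := ∫ x in Set.Ioo (-1 : ℝ) 1, (g x : ℂ) / (s - x)
/-- the real Cauchy transform -/
noncomputable def Cr (g : ℝ → ℝ) (s : ℝ) : ℝ := ∫ x in Set.Ioo (-1 : ℝ) 1, g x / (s - x)

lemma Cc_ofReal (g : ℝ → ℝ) (s : ℝ) : Cc g (s : ℂ) = (Cr g s : ℂ) := by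
  unfold Cc Cr
  rw [← integral_complex_ofReal]
  congr 1
  ext x
  push_cast
  rfl

lemma Cc_eq_T (g : ℝ → ℝ) {s : ℂ} (hs : s ∈ SV) : Cc g s = s⁻¹ * T g s⁻¹ := by
  unfold Cc T
  rw [← integral_const_mul]
  congr 1
  ext x
  have h0 := ne_zero_SV hs
  by_cases h : s - x = 0
  · have : 1 - (x : ℂ) * s⁻¹ = 0 := by
      rw [← sub_eq_zero.1 h, mul_inv_cancel₀ h0, sub_self]
    rw [h, this]; simp
  · have e : 1 - (x : ℂ) * s⁻¹ = (s - x) * s⁻¹ := by field_simp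
    rw [e]
    field_simp

lemma int_mul_cont {g : ℝ → ℝ} (hg : IntegrableOn g (Set.Ioo (-1) 1)) {k : ℝ → ℂ}
    (hk : ContinuousOn k (Set.Icc (-1) 1)) :
    IntegrableOn (fun x => (g x : ℂ) * k x) (Set.Ioo (-1) 1) := by
  obtain ⟨C, hC⟩ := isCompact_Icc.exists_bound_of_continuousOn hk
  refine Integrable.mul_bdd (c := C) hg.ofReal
    ((hk.mono Set.Ioo_subset_Icc_self).aestronglyMeasurable measurableSet_Ioo) ?_
  exact ae_restrict_of_forall_mem measurableSet_Ioo fun x hx => hC x (Set.Ioo_subset_Icc_self hx)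

lemma int_mul_cont_real {g : ℝ → ℝ} (hg : IntegrableOn g (Set.Ioo (-1) 1)) {k : ℝ → ℝ}
    (hk : ContinuousOn k (Set.Icc (-1) 1)) :
    IntegrableOn (fun x => g x * k x) (Set.Ioo (-1) 1) := by
  obtain ⟨C, hC⟩ := isCompact_Icc.exists_bound_of_continuousOn hk
  refine Integrable.mul_bdd (c := C) hg
    ((hk.mono Set.Ioo_subset_Icc_self).aestronglyMeasurable measurableSet_Ioo) ?_
  exact ae_restrict_of_forall_mem measurableSet_Ioo fun x hx => hC x (Set.Ioo_subset_Icc_self hx)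

lemma T_diff {g : ℝ → ℝ} (hg : IntegrableOn g (Set.Ioo (-1) 1)) : DifferentiableOn ℂ (T g) SU := by
  intro z₀ hz₀
  apply DifferentiableAt.differentiableWithinAt
  have hcont : ∀ z : ℂ, ContinuousOn (fun x : ℝ => 1 - (x : ℂ) * z) (Set.Icc (-1) 1) := by
    intro z; fun_prop
  obtain ⟨x₀, hx₀, hmin⟩ := isCompact_Icc.exists_isMinOn (⟨0, by norm_num⟩ : (Set.Icc (-1:ℝ) 1).Nonempty)
    ((hcont z₀).norm)
  set δ := ‖1 - (x₀ : ℂ) * z₀‖ with hδ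
  have hδ0 : 0 < δ := norm_pos_iff.2 (one_sub_ne hz₀ hx₀)
  have hb : ∀ z ∈ Metric.ball z₀ (δ / 2), ∀ x ∈ Set.Icc (-1 : ℝ) 1, δ / 2 ≤ ‖1 - (x : ℂ) * z‖ := by
    intro z hz x hx
    rw [Metric.mem_ball, dist_eq_norm] at hz
    have h1 : δ ≤ ‖1 - (x : ℂ) * z₀‖ := hmin hx
    have e : 1 - (x : ℂ) * z₀ = (1 - (x : ℂ) * z) + x * (z - z₀) := by ring
    rw [e] at h1
    have h2 := norm_add_le (1 - (x : ℂ) * z) (x * (z - z₀))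
    rw [norm_mul, Complex.norm_real, Real.norm_eq_abs] at h2
    have h3 : |x| * ‖z - z₀‖ ≤ 1 * ‖z - z₀‖ := by
      gcongr; exact abs_le.2 hx
    linarith
  have hint : ∀ z ∈ Metric.ball z₀ (δ / 2), IntegrableOn (fun x : ℝ => (g x : ℂ) / (1 - x * z)) (Set.Ioo (-1) 1) := by
    intro z hz
    have : ContinuousOn (fun x : ℝ => (1 - (x : ℂ) * z)⁻¹) (Set.Icc (-1) 1) := by
      apply (hcont z).inv₀
      intro x hx h
      have := hb z hz x hx
      rw [h, norm_zero] at this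
      linarith
    exact int_mul_cont hg this
  have := (hasDerivAt_integral_of_dominated_loc_of_deriv_le (μ := volume.restrict (Set.Ioo (-1:ℝ) 1))
    (F := fun (z : ℂ) (x : ℝ) => (g x : ℂ) / (1 - x * z))
    (F' := fun (z : ℂ) (x : ℝ) => (g x : ℂ) * (x / (1 - x * z) ^ 2))
    (bound := fun x => ‖g x‖ * (1 / (δ / 2) ^ 2))
    (Metric.ball_mem_nhds z₀ (half_pos hδ0)) ?_ ?_ ?_ ?_ ?_ ?_).2
  · exact this.differentiableAt
  · filter_upwards [Metric.ball_mem_nhds z₀ (half_pos hδ0)] with z hz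
    exact (hint z hz).aestronglyMeasurable
  · exact hint z₀ (Metric.mem_ball_self (half_pos hδ0))
  · refine (int_mul_cont hg (k := fun x => x / (1 - x * z₀) ^ 2) ?_).aestronglyMeasurable
    apply ContinuousOn.div (by fun_prop) (by fun_prop)
    intro x hx
    exact pow_ne_zero _ (one_sub_ne hz₀ hx)
  · refine ae_restrict_of_forall_mem measurableSet_Ioo fun x hx z hz => ?_
    have h1 := hb z hz x (Set.Ioo_subset_Icc_self hx)
    rw [norm_mul, Complex.norm_real, norm_div, norm_pow, Complex.norm_real]
    have : ‖x‖ ≤ 1 := abs_le.2 ⟨hx.1.le, hx.2.le⟩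
    gcongr
  · exact hg.norm.mul_const _
  · refine ae_restrict_of_forall_mem measurableSet_Ioo fun x hx z hz => ?_
    have h1 := hb z hz x (Set.Ioo_subset_Icc_self hx)
    have hne : 1 - (x : ℂ) * z ≠ 0 := by
      intro h
      rw [h, norm_zero] at h1
      linarith
    have h2 : HasDerivAt (fun z : ℂ => 1 - (x : ℂ) * z) (-((x : ℂ) * 1)) z :=
      ((hasDerivAt_id z).const_mul (x : ℂ)).const_sub 1
    convert! (h2.inv hne).const_mul (g x : ℂ) using 1
    simp

lemma Cc_cont {g : ℝ → ℝ} (hg : IntegrableOn g (Set.Ioo (-1) 1)) : ContinuousOn (Cc g) SV := by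
  have h : ContinuousOn (fun s => s⁻¹ * T g s⁻¹) SV := by
    have h1 : ContinuousOn (fun s : ℂ => s⁻¹) SV := by
      apply continuousOn_id.inv₀
      intro s hs; exact ne_zero_SV hs
    exact h1.mul ((T_diff hg).continuousOn.comp h1 fun s hs => inv_mem_SU hs)
  exact h.congr fun s hs => Cc_eq_T g hs

lemma T_conj (g : ℝ → ℝ) (z : ℂ) : T g (starRingEnd ℂ z) = starRingEnd ℂ (T g z) := by
  unfold T
  rw [← integral_conj]
  congr 1
  ext x
  simp


lemma f_real {α : ℝ} (hα0 : 0 < |α|) (hα2 : |α| < 1 / 2) {f : ℂ → ℂ}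
    (hf_dom : DifferentiableOn ℂ f SV)
    (hf_pearson : ∀ z ∈ SV, (z ^ 2 - 1) * deriv f z = 2 * (α : ℂ) * f z)
    (hf_inf : Tendsto f (cobounded ℂ) (𝓝 1)) {z : ℝ} (hz : 1 < z) :
    f z = (((z - 1) / (z + 1)) ^ α : ℝ) := by
  set w : ℝ → ℝ := fun z => ((z - 1) / (z + 1)) ^ (-α) with hw
  set u : ℝ → ℂ := fun z => f z * (w z : ℂ) with hu
  have hd : ∀ x ∈ Set.Ioi (1 : ℝ), HasDerivAt u 0 x := by
    intro x hx
    have hx1 : 1 < x := hx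
    have h1 : HasDerivAt f (deriv f x) (x : ℂ) :=
      (hf_dom.differentiableAt (SV_open.mem_nhds (real_mem_SV hx1))).hasDerivAt
    have h2 := h1.comp_ofReal
    have e1 : HasDerivAt (fun s : ℝ => (s - 1) / (s + 1)) (2 / (x + 1) ^ 2) x := by
      convert! ((hasDerivAt_id x).sub_const 1).div ((hasDerivAt_id x).add_const 1)
        (by simp only [id]; linarith : id x + 1 ≠ 0) using 1
      simp only [id]
      ring
    have hv : 0 < (x - 1) / (x + 1) := div_pos (by linarith) (by linarith)
    have e2 : HasDerivAt w (2 / (x + 1) ^ 2 * (-α) * ((x - 1) / (x + 1)) ^ (-α - 1)) x :=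
      e1.rpow_const (p := -α) (Or.inl hv.ne')
    have e3 := h2.mul e2.ofReal_comp
    convert! e3 using 1
    rw [Real.rpow_sub_one hv.ne']
    have hp := hf_pearson x (real_mem_SV hx1)
    have hne : ((x : ℂ) ^ 2 - 1) ≠ 0 := by
      norm_cast
      nlinarith
    have e4 : deriv f x = 2 * α * f x / ((x : ℂ) ^ 2 - 1) := by
      rw [eq_div_iff hne, ← hp]; ring
    rw [e4]
    have hh : 2 / (x + 1) ^ 2 * (-α) * (((x - 1) / (x + 1)) ^ (-α) / ((x - 1) / (x + 1))) =
        - (2 * α / (x ^ 2 - 1)) * w x := by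
      have : x - 1 ≠ 0 := by linarith
      have : x + 1 ≠ 0 := by linarith
      have : x ^ 2 - 1 = (x - 1) * (x + 1) := by ring
      rw [this, hw]
      simp only
      generalize ((x - 1) / (x + 1)) ^ (-α) = y
      field_simp
    rw [hh]
    push_cast
    ring
  have hconst : ∀ x ∈ Set.Ioi (1 : ℝ), u x = u z := fun x hx =>
    isOpen_Ioi.is_const_of_deriv_eq_zero isPreconnected_Ioi
      (fun y hy => (hd y hy).differentiableAt.differentiableWithinAt) (fun y hy => (hd y hy).deriv) hx hz
  have hlim : Tendsto u atTop (𝓝 1) := by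
    have h1 : Tendsto (fun x : ℝ => f (x : ℂ)) atTop (𝓝 1) :=
      hf_inf.comp (RCLike.tendsto_ofReal_atTop_cobounded ℂ)
    have h2 : Tendsto w atTop (𝓝 1) := by
      have h3 : Tendsto (fun x : ℝ => (x - 1) / (x + 1)) atTop (𝓝 1) := by
        have h4 : Tendsto (fun x : ℝ => 1 - 2 / (x + 1)) atTop (𝓝 (1 - 0)) := by
          apply Tendsto.const_sub
          exact Tendsto.div_atTop tendsto_const_nhds (tendsto_atTop_add_const_right _ _ tendsto_id)
        rw [sub_zero] at h4
        refine h4.congr' ?_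
        filter_upwards [eventually_gt_atTop 0] with x hx
        field_simp; ring
      have := h3.rpow_const (p := -α) (Or.inl one_ne_zero)
      simpa using this
    have h3 : Tendsto (fun x => (w x : ℂ)) atTop (𝓝 ((1 : ℝ) : ℂ)) :=
      (Complex.continuous_ofReal.tendsto _).comp h2
    simpa using h1.mul h3
  have h1 : u z = 1 := by
    refine tendsto_nhds_unique ?_ hlim
    refine tendsto_const_nhds.congr' ?_
    filter_upwards [eventually_gt_atTop 1] with x hx
    exact (hconst x hx).symm
  have hv : 0 < (z - 1) / (z + 1) := div_pos (by linarith) (by linarith)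
  rw [hu] at h1
  simp only [hw] at h1
  have : ((((z - 1) / (z + 1)) ^ (-α) : ℝ) : ℂ) * ((((z - 1) / (z + 1)) ^ α : ℝ) : ℂ) = 1 := by
    rw [← Complex.ofReal_mul, ← Real.rpow_add hv]; simp
  linear_combination (((((z - 1) / (z + 1)) ^ α : ℝ) : ℂ)) * h1 - f z * this

lemma f0_real {α : ℝ} (hα0 : 0 < |α|) (hα2 : |α| < 1 / 2) {f₀ : ℂ → ℂ}
    (hf_dom : DifferentiableOn ℂ f₀ SU)
    (hf_pearson : ∀ z ∈ SU, (z ^ 2 - 1) * deriv f₀ z = 2 * (α : ℂ) * f₀ z)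
    (hf_0 : f₀ 0 = 1) {z : ℝ} (hz : z ∈ Set.Ioo (-1 : ℝ) 1) :
    f₀ z = (W α z : ℝ) := by
  set u : ℝ → ℂ := fun z => f₀ z * (W (-α) z : ℂ) with hu
  have hd : ∀ x ∈ Set.Ioo (-1 : ℝ) 1, HasDerivAt u 0 x := by
    intro x hx
    have h1 : HasDerivAt f₀ (deriv f₀ x) (x : ℂ) :=
      (hf_dom.differentiableAt (SU_open.mem_nhds (real_mem_SU hx))).hasDerivAt
    have h2 := h1.comp_ofReal
    have hx1 : 0 < 1 + x := by linarith [hx.1]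
    have hx2 : 0 < 1 - x := by linarith [hx.2]
    have e1 : HasDerivAt (fun s : ℝ => (1 - s) / (1 + s)) (-2 / (1 + x) ^ 2) x := by
      convert! ((hasDerivAt_id x).const_sub 1).div ((hasDerivAt_id x).const_add 1)
        (by simp only [id]; linarith : 1 + id x ≠ 0) using 1
      simp only [id]
      ring
    have hv : 0 < (1 - x) / (1 + x) := div_pos (by linarith) (by linarith)
    have e2 : HasDerivAt (W (-α)) (-2 / (1 + x) ^ 2 * (-α) * ((1 - x) / (1 + x)) ^ (-α - 1)) x :=
      e1.rpow_const (p := -α) (Or.inl hv.ne')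
    have e3 := h2.mul e2.ofReal_comp
    convert! e3 using 1
    rw [Real.rpow_sub_one hv.ne']
    have hp := hf_pearson x (real_mem_SU hx)
    have hne : ((x : ℂ) ^ 2 - 1) ≠ 0 := by
      norm_cast
      nlinarith
    have e4 : deriv f₀ x = 2 * α * f₀ x / ((x : ℂ) ^ 2 - 1) := by
      rw [eq_div_iff hne, ← hp]; ring
    rw [e4]
    have hh : -2 / (1 + x) ^ 2 * (-α) * (((1 - x) / (1 + x)) ^ (-α) / ((1 - x) / (1 + x))) =
        - (2 * α / (x ^ 2 - 1)) * W (-α) x := by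
      have : x ^ 2 - 1 = - ((1 - x) * (1 + x)) := by ring
      rw [this]
      unfold W
      generalize ((1 - x) / (1 + x)) ^ (-α) = y
      field_simp
    rw [hh]
    push_cast
    ring
  have h1 : u z = u 0 :=
    isOpen_Ioo.is_const_of_deriv_eq_zero isPreconnected_Ioo
      (fun y hy => (hd y hy).differentiableAt.differentiableWithinAt) (fun y hy => (hd y hy).deriv) hz
      (by norm_num)
  have hv : 0 < (1 - z) / (1 + z) := div_pos (by linarith [hz.2]) (by linarith [hz.1])
  rw [hu] at h1
  simp only [Complex.ofReal_zero, hf_0, one_mul] at h1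
  have h0 : W (-α) 0 = 1 := by simp [W]
  rw [h0] at h1
  have : ((W (-α) z : ℝ) : ℂ) * ((W α z : ℝ) : ℂ) = 1 := by
    unfold W
    rw [← Complex.ofReal_mul, ← Real.rpow_add hv]; simp
  push_cast at h1
  linear_combination ((W α z : ℝ) : ℂ) * h1 - f₀ z * this

lemma alpha_ne {α : ℝ} (hα0 : 0 < |α|) (hα2 : |α| < 1 / 2) : α ≠ 0 := by
  rintro rfl; simp at hα0

lemma sin_ne {α : ℝ} (hα0 : 0 < |α|) (hα2 : |α| < 1 / 2) : Real.sin (Real.pi * α) ≠ 0 := by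
  have hα := alpha_ne hα0 hα2
  intro h
  have := Real.pi_pos
  obtain ⟨h1, h2⟩ := abs_lt.1 hα2
  have := (Real.sin_eq_zero_iff_of_lt_of_lt (x := Real.pi * α) (by nlinarith) (by nlinarith)).1 h
  rcases mul_eq_zero.1 this with h | h
  · exact Real.pi_ne_zero h
  · exact hα h

lemma cos_ne {α : ℝ} (hα0 : 0 < |α|) (hα2 : |α| < 1 / 2) : Real.cos (α * Real.pi) ≠ 0 := by
  have := Real.pi_pos
  obtain ⟨h1, h2⟩ := abs_lt.1 hα2
  exact ne_of_gt (Real.cos_pos_of_mem_Ioo ⟨by nlinarith, by nlinarith⟩)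

/-- constant -/
noncomputable def c1 (α : ℝ) : ℝ := -(Real.sin (Real.pi * α) / Real.pi)

lemma Cr_W {β : ℝ} (hb : |β| < 1) (hb0 : β ≠ 0) (hs : Real.sin (Real.pi * β) ≠ 0) {z : ℝ} (hz : 1 < z) :
    ((z - 1) / (z + 1)) ^ β = 1 + c1 β * Cr (W β) z := by
  set v := (z - 1) / (z + 1) with hv
  have hv0 : 0 < v := div_pos (by linarith) (by linarith)
  have hv1 : v < 1 := by rw [hv, div_lt_one (by linarith)]; linarith
  have hz' : (1 + v) / (1 - v) = z := by
    have h1 : 1 + v = 2 * z / (z + 1) := by rw [hv]; field_simp; ring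
    have h2 : 1 - v = 2 / (z + 1) := by rw [hv]; field_simp; ring
    rw [h1, h2]; field_simp
  have := W_cauchy hb hb0 hv0 hv1
  rw [hz'] at this
  unfold Cr c1
  rw [this]
  have := Real.pi_pos
  field_simp
  ring

lemma f0_T {α : ℝ} (hα0 : 0 < |α|) (hα2 : |α| < 1 / 2) {f₀ : ℂ → ℂ}
    (hf_dom : DifferentiableOn ℂ f₀ SU)
    (hf_pearson : ∀ z ∈ SU, (z ^ 2 - 1) * deriv f₀ z = 2 * (α : ℂ) * f₀ z)
    (hf_0 : f₀ 0 = 1) : Set.EqOn f₀ (fun z => 1 + (c1 α : ℂ) * (z * T (W α) z)) SU := by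
  have hWi := W_integrable (β := α) (by linarith) (alpha_ne hα0 hα2)
  refine AnalyticOnNhd.eqOn_of_preconnected_of_frequently_eq (z₀ := ((1/2 : ℝ) : ℂ))
    (hf_dom.analyticOnNhd SU_open)
    (DifferentiableOn.analyticOnNhd ?_ SU_open) SU_preconn (real_mem_SU (by norm_num)) ?_
  · exact ((differentiableOn_id.mul (T_diff hWi)).const_mul _).const_add _
  · have ht : Tendsto (fun x : ℝ => (x : ℂ)) (𝓝[>] (1/2 : ℝ)) (𝓝[≠] ((1/2 : ℝ) : ℂ)) := by
      apply tendsto_nhdsWithin_of_tendsto_nhds_of_eventually_within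
      · exact (Complex.continuous_ofReal.tendsto _).mono_left nhdsWithin_le_nhds
      · filter_upwards [self_mem_nhdsWithin] with x hx
        simp only [Set.mem_compl_iff, Set.mem_singleton_iff]
        intro h
        exact (ne_of_gt hx) (Complex.ofReal_injective h)
    refine ht.frequently (Eventually.frequently ?_)
    filter_upwards [Ioo_mem_nhdsGT (by norm_num : (1/2 : ℝ) < 1)] with t htt
    have ht0 : 0 < t := by linarith [htt.1]
    have hx : t ∈ Set.Ioo (-1 : ℝ) 1 := ⟨by linarith, htt.2⟩
    have hz : 1 < t⁻¹ := (one_lt_inv₀ ht0).2 htt.2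
    rw [f0_real hα0 hα2 hf_dom hf_pearson hf_0 hx]
    have h1 := Cr_W (by linarith) (alpha_ne hα0 hα2) (sin_ne hα0 hα2) hz
    have h2 := Cc_eq_T (W α) (real_mem_SV hz)
    rw [Cc_ofReal] at h2
    have e : W α t = ((t⁻¹ - 1) / (t⁻¹ + 1)) ^ α := by
      unfold W
      congr 1
      field_simp
    rw [e, h1]
    push_cast
    rw [h2]
    push_cast
    simp

end HP

namespace HP

lemma sub_ne {s : ℂ} (hs : s ∈ SV) {x : ℝ} (hx : x ∈ Set.Icc (-1 : ℝ) 1) : s - (x : ℂ) ≠ 0 := by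
  intro h
  apply hs
  rw [sub_eq_zero.1 h]
  simpa using abs_le.2 hx

lemma Cc_integrable {g : ℝ → ℝ} (hg : IntegrableOn g (Set.Ioo (-1) 1)) {s : ℂ} (hs : s ∈ SV) :
    IntegrableOn (fun x : ℝ => (g x : ℂ) / (s - x)) (Set.Ioo (-1) 1) := by
  have : ContinuousOn (fun x : ℝ => (s - (x : ℂ))⁻¹) (Set.Icc (-1) 1) := by
    apply ContinuousOn.inv₀ (by fun_prop)
    intro x hx
    exact sub_ne hs hx
  exact int_mul_cont hg this

lemma poly_int {g : ℝ → ℝ} (hg : IntegrableOn g (Set.Ioo (-1) 1)) (p : ℝ[X]) :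
    IntegrableOn (fun x => p.eval x * g x) (Set.Ioo (-1) 1) := by
  have := int_mul_cont_real hg (k := fun x => p.eval x) (by fun_prop)
  simpa only [mul_comm] using this

lemma Cc_add {g h : ℝ → ℝ} (hg : IntegrableOn g (Set.Ioo (-1) 1))
    (hh : IntegrableOn h (Set.Ioo (-1) 1)) {s : ℂ} (hs : s ∈ SV) :
    Cc (fun x => g x + h x) s = Cc g s + Cc h s := by
  unfold Cc
  rw [← integral_add (Cc_integrable hg hs) (Cc_integrable hh hs)]
  congr 1
  ext x
  push_cast
  ring

lemma Cc_smul (c : ℝ) (g : ℝ → ℝ) (s : ℂ) :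
    Cc (fun x => c * g x) s = c * Cc g s := by
  unfold Cc
  rw [← integral_const_mul]
  congr 1
  ext x
  push_cast
  ring

lemma Cc_X {g : ℝ → ℝ} (hg : IntegrableOn g (Set.Ioo (-1) 1)) {s : ℂ} (hs : s ∈ SV) :
    s * Cc g s = Cc (fun x => x * g x) s + ((∫ x in Set.Ioo (-1 : ℝ) 1, g x : ℝ) : ℂ) := by
  have hxg : IntegrableOn (fun x => x * g x) (Set.Ioo (-1) 1) := by
    simpa using poly_int hg X
  have hgc : Integrable (fun x => (g x : ℂ)) (volume.restrict (Set.Ioo (-1 : ℝ) 1)) := hg.ofReal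
  unfold Cc
  beta_reduce
  rw [← integral_complex_ofReal, ← integral_add (Cc_integrable hxg hs) hgc, ← integral_const_mul]
  apply setIntegral_congr_fun measurableSet_Ioo
  intro x hx
  have := sub_ne hs (Set.Ioo_subset_Icc_self hx)
  simp only
  push_cast
  field_simp
  ring

lemma Cc_poly {g : ℝ → ℝ} (hg : IntegrableOn g (Set.Ioo (-1) 1)) (p : ℝ[X]) :
    ∃ E : ℝ[X], ∀ s ∈ SV, aeval s p * Cc g s = Cc (fun x => p.eval x * g x) s + aeval s E := by
  induction p using Polynomial.induction_on with
  | C a =>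
    refine ⟨0, fun s hs => ?_⟩
    simp [Cc_smul]
  | add p q hp hq =>
    obtain ⟨E, hE⟩ := hp
    obtain ⟨F, hF⟩ := hq
    refine ⟨E + F, fun s hs => ?_⟩
    simp only [eval_add, add_mul, map_add]
    rw [Cc_add (poly_int hg p) (poly_int hg q) hs, hE s hs, hF s hs]
    ring
  | monomial n a ih =>
    obtain ⟨E, hE⟩ := ih
    refine ⟨X * E + C (∫ x in Set.Ioo (-1 : ℝ) 1, (C a * X ^ n : ℝ[X]).eval x * g x), fun s hs => ?_⟩
    have h1 := Cc_X (poly_int hg (C a * X ^ n)) hs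
    have h2 : (fun x => x * ((C a * X ^ n : ℝ[X]).eval x * g x))
        = (fun x => (C a * X ^ (n + 1) : ℝ[X]).eval x * g x) := by
      ext x; simp; ring
    rw [h2] at h1
    have h3 : aeval s (C a * X ^ (n + 1) : ℝ[X]) = s * aeval s (C a * X ^ n : ℝ[X]) := by
      simp; ring
    rw [h3, mul_assoc, hE s hs, mul_add, h1]
    simp only [map_add, map_mul, aeval_X, aeval_C, Complex.coe_algebraMap]
    ring

lemma aeval_ofReal (s : ℝ) (p : ℝ[X]) : aeval (s : ℂ) p = ((p.eval s : ℝ) : ℂ) := by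
  have := Polynomial.aeval_algebraMap_apply ℂ s p
  simpa using this

lemma Cr_poly {g : ℝ → ℝ} (hg : IntegrableOn g (Set.Ioo (-1) 1)) (p : ℝ[X]) :
    ∃ E : ℝ[X], ∀ s : ℝ, 1 < s → p.eval s * Cr g s = Cr (fun x => p.eval x * g x) s + E.eval s := by
  obtain ⟨E, hE⟩ := Cc_poly hg p
  refine ⟨E, fun s hs => ?_⟩
  have := hE s (real_mem_SV hs)
  rw [aeval_ofReal, aeval_ofReal, Cc_ofReal, Cc_ofReal] at this
  exact_mod_cast this

lemma Cr_X {g : ℝ → ℝ} (hg : IntegrableOn g (Set.Ioo (-1) 1)) {s : ℝ} (hs : 1 < s) :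
    s * Cr g s = Cr (fun x => x * g x) s + ∫ x in Set.Ioo (-1 : ℝ) 1, g x := by
  have := Cc_X hg (real_mem_SV hs)
  rw [Cc_ofReal, Cc_ofReal] at this
  exact_mod_cast this

lemma Cr_tendsto {g : ℝ → ℝ} (hg : IntegrableOn g (Set.Ioo (-1) 1)) :
    Tendsto (fun s => s * Cr g s) atTop (𝓝 (∫ x in Set.Ioo (-1 : ℝ) 1, g x)) := by
  unfold Cr
  simp only [← integral_const_mul]
  apply tendsto_integral_filter_of_dominated_convergence (fun x => 2 * ‖g x‖)
  · filter_upwards with s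
    exact (hg.aestronglyMeasurable.mul (by fun_prop : Measurable fun x : ℝ => (s - x)⁻¹).aestronglyMeasurable).const_mul s
  · filter_upwards [eventually_ge_atTop 2] with s hs
    refine ae_restrict_of_forall_mem measurableSet_Ioo fun x hx => ?_
    rw [← mul_div_assoc, mul_div_right_comm, norm_mul]
    have h1 : 0 < s - x := by linarith [hx.2]
    rw [Real.norm_of_nonneg (by positivity)]
    gcongr
    rw [div_le_iff₀ h1]
    linarith [hx.2]
  · exact hg.norm.const_mul 2
  · refine ae_restrict_of_forall_mem measurableSet_Ioo fun x hx => ?_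
    have h1 : Tendsto (fun s : ℝ => 1 + x / (s - x)) atTop (𝓝 (1 + 0)) := by
      apply Tendsto.const_add
      exact Tendsto.div_atTop tendsto_const_nhds (tendsto_atTop_add_const_right _ _ tendsto_id)
    have h2 := h1.mul_const (g x)
    rw [add_zero, one_mul] at h2
    refine h2.congr' ?_
    filter_upwards [eventually_gt_atTop x] with s hs
    have : s - x ≠ 0 := by linarith
    field_simp
    ring

lemma Cr_zero {g : ℝ → ℝ} (hg : IntegrableOn g (Set.Ioo (-1) 1)) :
    Tendsto (Cr g) atTop (𝓝 0) := by
  have h := (Cr_tendsto hg).mul tendsto_inv_atTop_zero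
  rw [mul_zero] at h
  refine h.congr' ?_
  filter_upwards [eventually_gt_atTop 0] with s hs
  field_simp

lemma inv_pow_tendsto (k : ℕ) : Tendsto (fun z : ℝ => (z ^ (k + 1))⁻¹) atTop (𝓝 0) :=
  tendsto_inv_atTop_zero.comp (tendsto_pow_atTop (by omega))

lemma moments_zero {g : ℝ → ℝ} (hg : IntegrableOn g (Set.Ioo (-1) 1)) (K : ℕ)
    (h : Cr g =O[atTop] fun z : ℝ => (z ^ (K + 1))⁻¹) :
    ∀ k < K, ∫ x in Set.Ioo (-1 : ℝ) 1, x ^ k * g x = 0 := by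
  induction K generalizing g with
  | zero => intro k hk; omega
  | succ K ih =>
    have hxg : IntegrableOn (fun x => x * g x) (Set.Ioo (-1) 1) := by
      simpa using poly_int hg X
    have h1 : (fun s => s * Cr g s) =O[atTop] fun z : ℝ => (z ^ (K + 1))⁻¹ := by
      have := (isBigO_refl (fun s : ℝ => s) atTop).mul h
      refine this.congr' EventuallyEq.rfl ?_
      filter_upwards [eventually_gt_atTop 0] with s hs
      field_simp
      ring
    have h2 : ∫ x in Set.Ioo (-1 : ℝ) 1, g x = 0 :=
      tendsto_nhds_unique (Cr_tendsto hg) (h1.trans_tendsto (inv_pow_tendsto K))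
    have h3 : Cr (fun x => x * g x) =O[atTop] fun z : ℝ => (z ^ (K + 1))⁻¹ := by
      refine h1.congr' ?_ EventuallyEq.rfl
      filter_upwards [eventually_gt_atTop 1] with s hs
      rw [Cr_X hg hs, h2, add_zero]
    intro k hk
    rcases k with _ | k
    · simpa using h2
    · have := ih hxg h3 k (by omega)
      rw [← this]
      congr 1
      ext x
      ring

lemma poly_zero {E : ℝ[X]} (h : Tendsto (fun x => E.eval x) atTop (𝓝 0)) : E = 0 := by
  have := (Polynomial.tendsto_nhds_iff E).1 h
  exact leadingCoeff_eq_zero.1 this.1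

lemma moments_poly {g : ℝ → ℝ} (hg : IntegrableOn g (Set.Ioo (-1) 1)) {K : ℕ}
    (h : ∀ k < K, ∫ x in Set.Ioo (-1 : ℝ) 1, x ^ k * g x = 0) {p : ℝ[X]} (hp : p.natDegree < K) :
    ∫ x in Set.Ioo (-1 : ℝ) 1, p.eval x * g x = 0 := by
  simp only [Polynomial.eval_eq_sum_range, Finset.sum_mul]
  rw [integral_finsetSum]
  · apply Finset.sum_eq_zero
    intro i hi
    simp only [mul_assoc]
    rw [integral_const_mul, h i (by simp at hi; omega), mul_zero]
  · intro i _
    have := poly_int hg (C (p.coeff i) * X ^ i)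
    simpa [IntegrableOn] using this

/-- remainder as a Cauchy transform -/
lemma remainder {g : ℝ → ℝ} (hg : IntegrableOn g (Set.Ioo (-1) 1)) {E : ℝ[X]} {R : ℝ → ℝ} {K : ℕ}
    (hR : ∀ s, 1 < s → R s = Cr g s + E.eval s)
    (hO : R =O[atTop] fun z : ℝ => (z ^ (K + 1))⁻¹) :
    (∀ s, 1 < s → R s = Cr g s) ∧ ∀ k < K, ∫ x in Set.Ioo (-1 : ℝ) 1, x ^ k * g x = 0 := by
  have hE : E = 0 := by
    apply poly_zero
    have := (hO.trans_tendsto (inv_pow_tendsto K)).sub (Cr_zero hg)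
    rw [sub_zero] at this
    refine this.congr' ?_
    filter_upwards [eventually_gt_atTop 1] with s hs
    rw [hR s hs]; ring
  have h1 : ∀ s, 1 < s → R s = Cr g s := by
    intro s hs
    rw [hR s hs, hE]; simp
  refine ⟨h1, moments_zero hg K (hO.congr' ?_ EventuallyEq.rfl)⟩
  filter_upwards [eventually_gt_atTop 1] with s hs
  exact h1 s hs

/-- integral zero of a signed continuous function -/
lemma pos_int {h : ℝ → ℝ} (hc : ContinuousOn h (Set.Ioo (-1) 1)) (hi : IntegrableOn h (Set.Ioo (-1) 1))
    (h0 : ∀ x ∈ Set.Ioo (-1 : ℝ) 1, 0 ≤ h x) (hint : ∫ x in Set.Ioo (-1 : ℝ) 1, h x = 0) :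
    ∀ x ∈ Set.Ioo (-1 : ℝ) 1, h x = 0 := by
  have h1 := (integral_eq_zero_iff_of_nonneg_ae (ae_restrict_of_forall_mem measurableSet_Ioo h0) hi).1 hint
  exact Measure.eqOn_open_of_ae_eq h1 isOpen_Ioo hc continuousOn_const

end HP

namespace HP

lemma factor {ρ : ℂ → ℂ} (hd : DifferentiableOn ℂ ρ SU) (m : ℂ → ℕ)
    (hord : ∀ x ∈ SU, (∀ j < m x, iteratedDeriv j ρ x = 0) ∧ iteratedDeriv (m x) ρ x ≠ 0)
    (S : Finset ℂ) (hS : ∀ x ∈ S, x ∈ SU) :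
    ∃ g : ℂ → ℂ, DifferentiableOn ℂ g SU ∧
      (∀ z ∈ SU, ρ z = (∏ x ∈ S, (z - x) ^ m x) * g z) ∧
      ∀ x ∈ SU, (x ∈ S ∨ ρ x ≠ 0) → g x ≠ 0 := by
  classical
  induction S using Finset.induction_on with
  | empty => exact ⟨ρ, hd, by simp, by simp⟩
  | insert a S ha ih =>
    obtain ⟨g, hg, hfac, hne⟩ := ih fun x hx => hS x (Finset.mem_insert_of_mem hx)
    have haU : a ∈ SU := hS a (Finset.mem_insert_self a S)
    have hga : AnalyticAt ℂ g a := hg.analyticOnNhd SU_open a haU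
    have hρa : AnalyticAt ℂ ρ a := hd.analyticOnNhd SU_open a haU
    have hPi : AnalyticAt ℂ (fun z => ∏ x ∈ S, (z - x) ^ m x) a := by fun_prop
    have hPi0 : (∏ x ∈ S, (a - x) ^ m x) ≠ 0 := by
      rw [Finset.prod_ne_zero_iff]
      intro x hx
      apply pow_ne_zero
      rw [sub_ne_zero]
      rintro rfl
      exact ha hx
    have ho : analyticOrderAt ρ a = m a := (analyticOrderAt_eq_nat_iff_iteratedDeriv_eq_zero hρa).2 (hord a haU)
    have hev : ρ =ᶠ[𝓝 a] (fun z => ∏ x ∈ S, (z - x) ^ m x) * g := by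
      filter_upwards [SU_open.mem_nhds haU] with z hz
      exact hfac z hz
    rw [analyticOrderAt_congr hev, analyticOrderAt_mul hPi hga,
      hPi.analyticOrderAt_eq_zero.2 hPi0, zero_add] at ho
    obtain ⟨k, hk, hk0, hkev⟩ := hga.analyticOrderAt_eq_natCast.1 ho
    set g' : ℂ → ℂ := fun z => if z = a then k a else g z / (z - a) ^ m a with hg'
    have hg'a : g' a = k a := by simp [hg']
    have hg'n : ∀ z, z ≠ a → g' z = g z / (z - a) ^ m a := by
      intro z hz; simp [hg', hz]
    refine ⟨g', ?_, ?_, ?_⟩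
    · intro z hz
      apply DifferentiableAt.differentiableWithinAt
      by_cases hza : z = a
      · subst hza
        refine hk.differentiableAt.congr_of_eventuallyEq ?_
        filter_upwards [hkev] with w hw
        by_cases hwa : w = z
        · rw [hwa, hg'a]
        · rw [hg'n w hwa, hw, smul_eq_mul]
          have : w - z ≠ 0 := sub_ne_zero.2 hwa
          field_simp
      · have hd1 : DifferentiableAt ℂ (fun z => g z / (z - a) ^ m a) z := by
          apply (hg.differentiableAt (SU_open.mem_nhds hz)).div (by fun_prop)
          exact pow_ne_zero _ (sub_ne_zero.2 hza)
        refine hd1.congr_of_eventuallyEq ?_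
        filter_upwards [isOpen_ne.mem_nhds hza] with w hw
        exact hg'n w hw
    · intro z hz
      rw [Finset.prod_insert ha, hfac z hz]
      by_cases hza : z = a
      · subst hza
        have := hkev.self_of_nhds
        rw [this, hg'a, smul_eq_mul]
        ring
      · rw [hg'n z hza]
        have : z - a ≠ 0 := sub_ne_zero.2 hza
        field_simp
    · intro x hx hxx
      by_cases hza : x = a
      · rw [hza, hg'a]; exact hk0
      · rw [hg'n x hza]
        apply div_ne_zero _ (pow_ne_zero _ (sub_ne_zero.2 hza))
        apply hne x hx
        rcases hxx with h | h
        · exact Or.inl ((Finset.mem_insert.1 h).resolve_left hza)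
        · exact Or.inr h

lemma dvd_roots {V : Set ℂ} (hV : IsOpen V) (s : Multiset ℂ) :
    ∀ (E : ℂ[X]) (h : ℂ → ℂ), ContinuousOn h V → (∀ r ∈ s, r ∈ V) →
    (∀ z ∈ V, E.eval z = ((s.map fun a => X - C a).prod).eval z * h z) →
    (s.map fun a => X - C a).prod ∣ E := by
  induction s using Multiset.induction_on with
  | empty => intro E h _ _ _; simp
  | cons a s ih =>
    intro E h hc hr hE
    have ha : a ∈ V := hr a (Multiset.mem_cons_self a s)
    have hEa : E.IsRoot a := by
      have := hE a ha
      simpa using this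
    obtain ⟨E₁, hE₁⟩ := dvd_iff_isRoot.2 hEa
    rw [Multiset.map_cons, Multiset.prod_cons, hE₁]
    apply mul_dvd_mul_left
    apply ih E₁ h hc fun r hr' => hr r (Multiset.mem_cons_of_mem hr')
    set p := (s.map fun a => X - C a).prod with hp
    have hne : ∀ z ∈ V, z ≠ a → E₁.eval z = p.eval z * h z := by
      intro z hz hza
      have := hE z hz
      rw [hE₁, Multiset.map_cons, Multiset.prod_cons] at this
      simp only [eval_mul, eval_sub, eval_X, eval_C] at this
      have h0 : z - a ≠ 0 := sub_ne_zero.2 hza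
      apply mul_left_cancel₀ h0
      rw [this, ← hp]; ring
    intro z hz
    by_cases hza : z = a
    · subst hza
      have h1 : Tendsto (fun w => E₁.eval w) (𝓝[≠] z) (𝓝 (E₁.eval z)) :=
        (E₁.continuous.tendsto z).mono_left nhdsWithin_le_nhds
      have h2 : Tendsto (fun w => p.eval w * h w) (𝓝[≠] z) (𝓝 (p.eval z * h z)) :=
        ((p.continuous.tendsto z).mul (hc.continuousAt (hV.mem_nhds hz))).mono_left nhdsWithin_le_nhds
      refine tendsto_nhds_unique h1 (h2.congr' ?_)
      filter_upwards [self_mem_nhdsWithin, nhdsWithin_le_nhds (hV.mem_nhds hz)] with w hw hwV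
      exact (hne w hwV hw).symm
    · exact hne z hz hza

lemma dvd_factor {V : Set ℂ} (hV : IsOpen V) {P E : ℝ[X]} (hP : P ≠ 0) {h : ℂ → ℂ}
    (hc : ContinuousOn h V) (hr : ∀ z : ℂ, aeval z P = 0 → z ∈ V)
    (hE : ∀ z ∈ V, aeval z E = aeval z P * h z) : P ∣ E := by
  set φ := algebraMap ℝ ℂ with hφ
  rw [← Polynomial.map_dvd_map' φ]
  set Pc := P.map φ with hPc
  have hPc0 : Pc ≠ 0 := (Polynomial.map_ne_zero_iff φ.injective).2 hP
  have hs := (IsAlgClosed.splits Pc).eq_prod_roots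
  have hl : Pc.leadingCoeff ≠ 0 := leadingCoeff_ne_zero.2 hPc0
  have h1 := dvd_roots hV Pc.roots (E.map φ) (fun z => Pc.leadingCoeff * h z) (continuousOn_const.mul hc) ?_ ?_
  · rw [hs]
    exact (IsUnit.dvd_mul_left (isUnit_C.2 (IsUnit.mk0 _ hl))).1 (by
      have := mul_dvd_mul_left (C Pc.leadingCoeff) h1
      have h2 : C Pc.leadingCoeff * E.map φ ∣ E.map φ * C Pc.leadingCoeff := by rw [mul_comm]
      have := this.trans h2
      obtain ⟨d, hd⟩ := this
      refine ⟨d, ?_⟩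
      rw [← hd]; ring)
  · intro r hrr
    apply hr
    have := (mem_roots'.1 hrr).2
    rwa [IsRoot.def, hPc, eval_map_algebraMap] at this
  · intro z hz
    have h2 := hE z hz
    rw [← eval_map_algebraMap, ← eval_map_algebraMap, ← hφ, ← hPc] at h2
    rw [h2]
    nth_rewrite 1 [hs]
    rw [eval_mul, eval_C]
    ring

lemma same_sign {S : Set ℝ} (hS : IsPreconnected S) {h : ℝ → ℝ} (hc : ContinuousOn h S)
    (h0 : ∀ x ∈ S, h x ≠ 0) {x y : ℝ} (hx : x ∈ S) (hy : y ∈ S) : 0 < h x * h y := by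
  by_contra hcon
  have hne := mul_ne_zero (h0 x hx) (h0 y hy)
  have hlt : h x * h y < 0 := lt_of_le_of_ne (not_lt.1 hcon) hne
  have ho := (hS.image h hc).ordConnected
  have : (0 : ℝ) ∈ h '' S := by
    apply ho.uIcc_subset (Set.mem_image_of_mem h hx) (Set.mem_image_of_mem h hy)
    rw [Set.mem_uIcc]
    rcases mul_neg_iff.1 hlt with ⟨h1, h2⟩ | ⟨h1, h2⟩
    · right; exact ⟨h2.le, h1.le⟩
    · left; exact ⟨h1.le, h2.le⟩
  obtain ⟨w, hw, hw0⟩ := this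
  exact h0 w hw hw0

lemma reflect_aeval {p : ℝ[X]} {N : ℕ} (hp : p.natDegree ≤ N) {s : ℂ} (hs : s ≠ 0) :
    aeval s (reflect N p) = s ^ N * aeval s⁻¹ p := by
  let _inst : Invertible s⁻¹ := ⟨s, mul_inv_cancel₀ hs, inv_mul_cancel₀ hs⟩
  have := eval₂_reflect_mul_pow (algebraMap ℝ ℂ) s⁻¹ N p hp
  have e : ⅟(s⁻¹) = s := rfl
  rw [e] at this
  rw [aeval_def, aeval_def, ← this, mul_comm, mul_assoc, inv_pow, inv_mul_cancel₀ (pow_ne_zero _ hs), mul_one]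

lemma poly_zero_Ioo {p : ℝ[X]} (h : ∀ x ∈ Set.Ioo (-1 : ℝ) 1, p.eval x = 0) : p = 0 := by
  apply Polynomial.eq_zero_of_infinite_isRoot
  exact (Set.Ioo_infinite (by norm_num : (-1 : ℝ) < 1)).mono h

end HP

namespace HP

lemma upper {α : ℝ} (hα0 : 0 < |α|) (hα2 : |α| < 1 / 2) {f₀ : ℂ → ℂ}
    (hT : Set.EqOn f₀ (fun z => 1 + (c1 α : ℂ) * (z * T (W α) z)) SU) {n : ℕ} {Q1 Q2 : ℝ[X]}
    (h1 : Q1.natDegree ≤ n) (h2 : Q2.natDegree ≤ n) {ρ : ℂ → ℂ}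
    (hρ : ρ = fun z : ℂ => aeval z Q1 + ((2 * Real.cos (α * Real.pi) : ℝ) : ℂ) * aeval z Q2 * f₀ z)
    {Pz : ℝ[X]} (hPz0 : Pz ≠ 0) (hPz : ∀ z : ℂ, aeval z Pz = 0 → z ∈ SU)
    (hM : 2 * n + 2 ≤ Pz.natDegree) {g : ℂ → ℂ} (hg : ContinuousOn g SU)
    (hfac : ∀ z ∈ SU, ρ z = aeval z Pz * g z) : ∀ᶠ s : ℝ in atTop, ρ ((s : ℂ)⁻¹) = 0 := by
  set M := Pz.natDegree with hMdef
  set P := reflect M Pz with hP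
  set q1 := reflect n Q1 with hq1
  set q2 := reflect n Q2 with hq2
  set k2 : ℝ := 2 * Real.cos (α * Real.pi) with hk2
  set c : ℝ := k2 * c1 α with hc
  have hk20 : k2 ≠ 0 := mul_ne_zero two_ne_zero (cos_ne hα0 hα2)
  have hc0 : c ≠ 0 := mul_ne_zero hk20
    (neg_ne_zero.2 (div_ne_zero (sin_ne hα0 hα2) Real.pi_ne_zero))
  have hWi := W_integrable (β := α) (by linarith) (alpha_ne hα0 hα2)
  have hP0 : P ≠ 0 := by rw [hP, Ne, reflect_eq_zero_iff]; exact hPz0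
  have hPeval0 : P.eval 0 ≠ 0 := by
    rw [← coeff_zero_eq_eval_zero, hP, coeff_reflect, revAt_le (Nat.zero_le _), Nat.sub_zero]
    exact leadingCoeff_ne_zero.2 hPz0
  have hPs : ∀ s : ℂ, s ≠ 0 → aeval s P = s ^ M * aeval s⁻¹ Pz := fun s hs => reflect_aeval le_rfl hs
  have hroots : ∀ s : ℂ, aeval s P = 0 → s ∈ SV := by
    intro s hs
    by_contra hcon
    have hcon' : s.im = 0 ∧ |s.re| ≤ 1 := not_not.1 hcon
    have es : s = (s.re : ℂ) := by apply Complex.ext <;> simp [hcon'.1]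
    by_cases h0 : s = 0
    · have : aeval ((0 : ℝ) : ℂ) P = 0 := by rw [← hs, h0]; simp
      rw [aeval_ofReal] at this
      exact hPeval0 (by exact_mod_cast this)
    · rw [hPs s h0] at hs
      have h3 := hPz _ ((mul_eq_zero.1 hs).resolve_left (pow_ne_zero _ h0))
      apply h3
      rw [es, ← Complex.ofReal_inv]
      simp only [Complex.ofReal_im, Complex.ofReal_re, true_and]
      rw [abs_inv]
      apply (one_le_inv₀ _).2 hcon'.2
      rw [abs_pos]
      intro h
      rw [h] at es
      exact h0 (by simpa using es)
  have hPne : ∀ x ∈ Set.Icc (-1 : ℝ) 1, P.eval x ≠ 0 := by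
    intro x hx h
    have : aeval (x : ℂ) P = 0 := by rw [aeval_ofReal, h]; simp
    apply hroots _ this
    simpa using abs_le.2 hx
  have hsign : ∀ x ∈ Set.Icc (-1 : ℝ) 1, 0 < P.eval 0 * P.eval x := fun x hx =>
    same_sign isPreconnected_Icc P.continuous.continuousOn hPne (by norm_num) hx
  set gK : ℝ → ℝ := fun x => W α x * (q2.eval x / P.eval x) with hgK
  have hgKi : IntegrableOn gK (Set.Ioo (-1) 1) := by
    apply int_mul_cont_real hWi
    exact ContinuousOn.div (by fun_prop) (by fun_prop) hPne
  obtain ⟨EP, hEP⟩ := Cc_poly hgKi P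
  obtain ⟨E2, hE2⟩ := Cc_poly hWi q2
  have hCeq : ∀ s, Cc (fun x => P.eval x * gK x) s = Cc (fun x => q2.eval x * W α x) s := by
    intro s
    unfold Cc
    apply setIntegral_congr_fun measurableSet_Ioo
    intro x hx
    have := hPne x (Set.Ioo_subset_Icc_self hx)
    simp only [hgK]
    congr 2
    field_simp
  set E := q1 + C k2 * q2 + C c * E2 - C c * EP with hE
  set h : ℂ → ℂ := fun s => (s⁻¹) ^ (M - n) * g s⁻¹ - c * Cc gK s with hh
  have hρs : ∀ s ∈ SV, s ^ n * ρ s⁻¹ = aeval s P * ((s⁻¹) ^ (M - n) * g s⁻¹) := by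
    intro s hs
    have hs0 := ne_zero_SV hs
    rw [hfac _ (inv_mem_SU hs), hPs s hs0]
    have : s ^ M = s ^ n * s ^ (M - n) := by rw [← pow_add]; congr 1; omega
    rw [this]
    have h3 : s ^ (M - n) * (s⁻¹) ^ (M - n) = 1 := by rw [← mul_pow, mul_inv_cancel₀ hs0, one_pow]
    linear_combination -(s ^ n * aeval s⁻¹ Pz * g s⁻¹) * h3
  have hEs : ∀ s ∈ SV, aeval s E = aeval s P * h s := by
    intro s hs
    have hs0 := ne_zero_SV hs
    have e1 := hρs s hs
    have e2 : s ^ n * ρ s⁻¹ = aeval s q1 + k2 * aeval s q2 * (1 + (c1 α : ℂ) * Cc (W α) s) := by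
      rw [hq1, hq2, reflect_aeval h1 hs0, reflect_aeval h2 hs0, hρ, Cc_eq_T _ hs]
      simp only
      rw [hT (inv_mem_SU hs)]
      ring
    have e3 := hEP s hs
    have e4 := hE2 s hs
    rw [hCeq] at e3
    simp only [hE, hh, map_add, map_sub, map_mul, aeval_C, Complex.coe_algebraMap, hc, Complex.ofReal_mul]
    linear_combination e1 - e2 + (k2 * c1 α : ℂ) * e3 - (k2 * c1 α : ℂ) * e4
  have hhc : ContinuousOn h SV := by
    have h3 : ContinuousOn (fun s : ℂ => s⁻¹) SV := by
      apply continuousOn_id.inv₀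
      intro s hs; exact ne_zero_SV hs
    exact ((h3.pow _).mul (hg.comp h3 fun s hs => inv_mem_SU hs)).sub (continuousOn_const.mul (Cc_cont hgKi))
  obtain ⟨D, hD⟩ := dvd_factor SV_open hP0 hhc hroots hEs
  have hPev : ∀ᶠ s : ℝ in atTop, P.eval s ≠ 0 := by
    have hfin : {x | P.IsRoot x}.Finite := Polynomial.finite_setOfPred_isRoot hP0
    have := hfin.isCompact.isBounded
    obtain ⟨B, hB⟩ := hfin.bddAbove
    filter_upwards [eventually_gt_atTop B] with s hs h0
    exact absurd (hB h0) (not_le.2 hs)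
  have hDh : ∀ᶠ s : ℝ in atTop, h s = ((D.eval s : ℝ) : ℂ) := by
    filter_upwards [hPev, eventually_gt_atTop 1] with s hs hs1
    have e := hEs s (real_mem_SV hs1)
    rw [hD, map_mul, aeval_ofReal, aeval_ofReal] at e
    have : ((P.eval s : ℝ) : ℂ) ≠ 0 := by exact_mod_cast hs
    exact (mul_left_cancel₀ this e).symm
  have hinv : Tendsto (fun s : ℝ => ((s : ℂ))⁻¹) atTop (𝓝 0) := by
    have := (Complex.continuous_ofReal.tendsto 0).comp (tendsto_inv_atTop_zero (𝕜 := ℝ))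
    simpa [Function.comp_def] using this
  have hgt : Tendsto (fun s : ℝ => g ((s : ℂ))⁻¹) atTop (𝓝 (g 0)) :=
    (hg.continuousAt (SU_open.mem_nhds zero_mem_SU)).tendsto.comp hinv
  have hh0 : Tendsto (fun s : ℝ => h s) atTop (𝓝 0) := by
    have h3 : Tendsto (fun s : ℝ => (((s : ℂ))⁻¹) ^ (M - n)) atTop (𝓝 0) := by
      have := hinv.pow (M - n)
      rwa [zero_pow (by omega)] at this
    have h4 : Tendsto (fun s : ℝ => Cc gK s) atTop (𝓝 0) := by
      simp only [Cc_ofReal]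
      have := (Complex.continuous_ofReal.tendsto 0).comp (Cr_zero hgKi)
      simpa [Function.comp_def] using this
    have := (h3.mul hgt).sub (h4.const_mul (c : ℂ))
    simpa [hh] using this
  have hD0 : D = 0 := by
    apply poly_zero
    have := (Complex.continuous_re.tendsto 0).comp (hh0.congr' hDh)
    simpa [Function.comp_def] using this
  have hkey : ∀ᶠ s : ℝ in atTop, (c : ℂ) * Cr gK s = (((s : ℂ))⁻¹) ^ (M - n) * g ((s : ℂ))⁻¹ := by
    filter_upwards [hDh] with s hs
    rw [hD0] at hs
    simp only [eval_zero, Complex.ofReal_zero, hh, Cc_ofReal] at hs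
    linear_combination -hs
  have hO : Cr gK =O[atTop] fun z : ℝ => (z ^ (n + 1 + 1))⁻¹ := by
    have hbd : ∀ᶠ s : ℝ in atTop, ‖g ((s : ℂ))⁻¹‖ < ‖g 0‖ + 1 :=
      hgt.norm.eventually (gt_mem_nhds (by linarith))
    refine IsBigO.of_bound ((‖g 0‖ + 1) / |c|) ?_
    filter_upwards [hkey, hbd, eventually_ge_atTop 1] with s hs hb hs1
    have hcpos : 0 < |c| := abs_pos.2 hc0
    have e := congrArg norm hs
    rw [norm_mul, norm_mul, norm_pow, norm_inv, Complex.norm_real, Complex.norm_real, Complex.norm_real,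
      Real.norm_eq_abs c, Real.norm_of_nonneg (by linarith : 0 ≤ s)] at e
    rw [Real.norm_of_nonneg (by positivity : 0 ≤ (s ^ (n + 1 + 1))⁻¹), div_mul_eq_mul_div,
      le_div_iff₀ hcpos, mul_comm, e, mul_comm, ← inv_pow]
    have : (s⁻¹) ^ (M - n) ≤ (s⁻¹) ^ (n + 1 + 1) :=
      pow_le_pow_of_le_one (by positivity) (inv_le_one_of_one_le₀ hs1) (by omega)
    gcongr
  have hmom := moments_zero hgKi (n + 1) hO
  have hq2deg : q2.natDegree < n + 1 := by
    have := natDegree_reflect_le (N := n) (p := Q2)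
    rw [← hq2] at this
    have := max_le le_rfl h2
    omega
  have hint0 := moments_poly hgKi hmom hq2deg
  have hz := pos_int (h := fun x => P.eval 0 * (q2.eval x * gK x)) ?_ ?_ ?_ ?_
  · have hq20 : ∀ x ∈ Set.Ioo (-1 : ℝ) 1, q2.eval x = 0 := by
      intro x hx
      have := hz x hx
      have hw := (W_pos (β := α) hx).ne'
      have hp := hPne x (Set.Ioo_subset_Icc_self hx)
      simp only [hgK, mul_eq_zero, div_eq_zero_iff] at this
      tauto
    have hCr0 : ∀ s, Cr gK s = 0 := by
      intro s
      unfold Cr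
      rw [setIntegral_congr_fun (g := fun _ => 0) measurableSet_Ioo]
      · simp
      · intro x hx
        simp [hgK, hq20 x hx]
    filter_upwards [hkey, eventually_gt_atTop 1] with s hs hs1
    rw [hCr0] at hs
    have hs0 := ne_zero_SV (real_mem_SV hs1)
    have h3 : ((s : ℂ)⁻¹) ^ (M - n) ≠ 0 := pow_ne_zero _ (inv_ne_zero hs0)
    have h4 : g ((s : ℂ))⁻¹ = 0 := by
      simp only [Complex.ofReal_zero, mul_zero] at hs
      exact (mul_eq_zero.1 hs.symm).resolve_left h3
    rw [hfac _ (inv_mem_SU (real_mem_SV hs1)), h4, mul_zero]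
  · apply continuousOn_const.mul
    apply ContinuousOn.mul (by fun_prop)
    apply (W_cont α).mul
    exact ContinuousOn.div (by fun_prop) (by fun_prop) fun x hx => hPne x (Set.Ioo_subset_Icc_self hx)
  · exact (poly_int hgKi q2).const_mul _
  · intro x hx
    have hw := W_pos (β := α) hx
    have hp := hsign x (Set.Ioo_subset_Icc_self hx)
    have hp0 := hPne x (Set.Ioo_subset_Icc_self hx)
    have : P.eval 0 * (q2.eval x * gK x) = (P.eval 0 * P.eval x) * (q2.eval x / P.eval x) ^ 2 * W α x := by
      simp only [hgK]; field_simp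
    rw [this]
    positivity
  · rw [integral_const_mul, hint0, mul_zero]

end HP

namespace HP

/-- real version of `ρ` -/
noncomputable def rr (α : ℝ) (Q : Fin 3 → ℝ[X]) (x : ℝ) : ℝ :=
  (Q 1).eval x + 2 * Real.cos (α * Real.pi) * (Q 2).eval x * W α x
/-- real version of the remainder -/
noncomputable def RR (α : ℝ) (Q : Fin 3 → ℝ[X]) (z : ℝ) : ℝ :=
  (Q 0).eval z + (Q 1).eval z * ((z - 1) / (z + 1)) ^ α + (Q 2).eval z * (((z - 1) / (z + 1)) ^ α) ^ 2
/-- the weight -/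
noncomputable def gg (α : ℝ) (Q : Fin 3 → ℝ[X]) (x : ℝ) : ℝ := c1 α * (W α x * rr α Q x)

lemma c1_ne {α : ℝ} (hα0 : 0 < |α|) (hα2 : |α| < 1 / 2) : c1 α ≠ 0 :=
  neg_ne_zero.2 (div_ne_zero (sin_ne hα0 hα2) Real.pi_ne_zero)

lemma c1_two (α : ℝ) : c1 (2 * α) = 2 * Real.cos (α * Real.pi) * c1 α := by
  unfold c1
  rw [show Real.pi * (2 * α) = 2 * (Real.pi * α) by ring, Real.sin_two_mul, mul_comm α Real.pi]
  ring

lemma W_two (α : ℝ) {x : ℝ} (hx : x ∈ Set.Ioo (-1 : ℝ) 1) : W (2 * α) x = W α x ^ 2 := by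
  unfold W
  have : 0 ≤ (1 - x) / (1 + x) := div_nonneg (by linarith [hx.2]) (by linarith [hx.1])
  rw [mul_comm, Real.rpow_mul this]
  norm_num

lemma gg_eq (α : ℝ) (Q : Fin 3 → ℝ[X]) : Set.EqOn (gg α Q) (fun x => c1 α * ((Q 1).eval x * W α x)
    + c1 (2 * α) * ((Q 2).eval x * W (2 * α) x)) (Set.Ioo (-1) 1) := by
  intro x hx
  simp only [gg, rr, W_two α hx, c1_two]
  ring

lemma W2_int {α : ℝ} (hα0 : 0 < |α|) (hα2 : |α| < 1 / 2) : IntegrableOn (W (2 * α)) (Set.Ioo (-1) 1) :=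
  W_integrable (by rw [abs_mul]; norm_num; linarith) (mul_ne_zero two_ne_zero (alpha_ne hα0 hα2))

lemma gg_int {α : ℝ} (hα0 : 0 < |α|) (hα2 : |α| < 1 / 2) (Q : Fin 3 → ℝ[X]) :
    IntegrableOn (gg α Q) (Set.Ioo (-1) 1) := by
  rw [integrableOn_congr_fun (gg_eq α Q) measurableSet_Ioo]
  have hWi := W_integrable (β := α) (by linarith) (alpha_ne hα0 hα2)
  exact ((poly_int hWi _).const_mul _).add ((poly_int (W2_int hα0 hα2) _).const_mul _)

lemma Cr_congr {g h : ℝ → ℝ} (hgh : Set.EqOn g h (Set.Ioo (-1) 1)) (s : ℝ) : Cr g s = Cr h s := by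
  unfold Cr
  apply setIntegral_congr_fun measurableSet_Ioo
  intro x hx
  simp only [hgh hx]

lemma RR_O {α : ℝ} (hα0 : 0 < |α|) (hα2 : |α| < 1 / 2) {f : ℂ → ℂ}
    (hf_dom : DifferentiableOn ℂ f SV)
    (hf_pearson : ∀ z ∈ SV, (z ^ 2 - 1) * deriv f z = 2 * (α : ℂ) * f z)
    (hf_inf : Tendsto f (cobounded ℂ) (𝓝 1)) {n : ℕ} {Q : Fin 3 → ℝ[X]}
    (hHP : (fun z : ℂ => aeval z (Q 0) + aeval z (Q 1) * f z + aeval z (Q 2) * f z ^ 2)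
      =O[cobounded ℂ] fun z => (z ^ (2 * n + 2))⁻¹) :
    RR α Q =O[atTop] fun z : ℝ => (z ^ (2 * n + 1 + 1))⁻¹ := by
  have h := hHP.comp_tendsto (RCLike.tendsto_ofReal_atTop_cobounded ℂ)
  have h2 : (fun z : ℝ => ((RR α Q z : ℝ) : ℂ)) =O[atTop] fun z : ℝ => (((z ^ (2 * n + 2))⁻¹ : ℝ) : ℂ) := by
    refine h.congr' ?_ ?_
    · filter_upwards [eventually_gt_atTop 1] with z hz
      have := f_real hα0 hα2 hf_dom hf_pearson hf_inf hz
      simp only [Function.comp_apply, Complex.coe_algebraMap, RCLike.ofReal_eq_complex_ofReal] at this ⊢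
      simp only [this, aeval_ofReal, RR]
      push_cast
      ring
    · filter_upwards with z
      simp
  exact (isBigO_norm_norm.1 (by simpa only [Complex.norm_real] using h2.norm_norm))

lemma RR_Cr {α : ℝ} (hα0 : 0 < |α|) (hα2 : |α| < 1 / 2) {n : ℕ} {Q : Fin 3 → ℝ[X]}
    (hO : RR α Q =O[atTop] fun z : ℝ => (z ^ (2 * n + 1 + 1))⁻¹) :
    (∀ s, 1 < s → RR α Q s = Cr (gg α Q) s) ∧
      ∀ k < 2 * n + 1, ∫ x in Set.Ioo (-1 : ℝ) 1, x ^ k * gg α Q x = 0 := by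
  have hWi := W_integrable (β := α) (by linarith) (alpha_ne hα0 hα2)
  have hW2 := W2_int hα0 hα2
  have hα := alpha_ne hα0 hα2
  obtain ⟨E1, hE1⟩ := Cr_poly hWi (Q 1)
  obtain ⟨E2, hE2⟩ := Cr_poly hW2 (Q 2)
  have hs2 : Real.sin (Real.pi * (2 * α)) ≠ 0 := by
    rw [show Real.pi * (2 * α) = 2 * (Real.pi * α) by ring, Real.sin_two_mul, mul_comm Real.pi α]
    have := sin_ne hα0 hα2
    rw [mul_comm] at this
    exact mul_ne_zero (mul_ne_zero two_ne_zero this) (cos_ne hα0 hα2)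
  refine remainder (gg_int hα0 hα2 Q)
    (E := Q 0 + Q 1 + Q 2 + C (c1 α) * E1 + C (c1 (2 * α)) * E2) ?_ hO
  intro s hs
  have a1 := Cr_W (β := α) (by linarith) hα (sin_ne hα0 hα2) hs
  have a2 := Cr_W (β := 2 * α) (by rw [abs_mul]; norm_num; linarith) (mul_ne_zero two_ne_zero hα) hs2 hs
  have a3 : ((s - 1) / (s + 1)) ^ (2 * α) = (((s - 1) / (s + 1)) ^ α) ^ 2 := by
    rw [mul_comm, Real.rpow_mul (div_nonneg (by linarith) (by linarith))]; norm_num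
  have a4 : Cr (gg α Q) s = c1 α * Cr (fun x => (Q 1).eval x * W α x) s
      + c1 (2 * α) * Cr (fun x => (Q 2).eval x * W (2 * α) x) s := by
    rw [Cr_congr (gg_eq α Q)]
    have b := Cc_add ((poly_int hWi (Q 1)).const_mul (c1 α)) ((poly_int hW2 (Q 2)).const_mul (c1 (2 * α)))
      (real_mem_SV hs)
    rw [Cc_smul, Cc_smul] at b
    simp only [Cc_ofReal] at b
    exact_mod_cast b
  unfold RR
  rw [← a3, a1, a2, a4]
  have b1 := hE1 s hs
  have b2 := hE2 s hs
  simp only [eval_add, eval_mul, eval_C]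
  linear_combination c1 α * b1 + c1 (2 * α) * b2

lemma RR_p {α : ℝ} (hα0 : 0 < |α|) (hα2 : |α| < 1 / 2) {n : ℕ} {Q : Fin 3 → ℝ[X]}
    (hO : RR α Q =O[atTop] fun z : ℝ => (z ^ (2 * n + 1 + 1))⁻¹) {p : ℝ[X]} (hp : p.natDegree ≤ 2 * n + 1)
    {s : ℝ} (hs : 1 < s) :
    p.eval s * RR α Q s = Cr (fun x => p.eval x * gg α Q x) s := by
  have hg := gg_int hα0 hα2 Q
  obtain ⟨E, hE⟩ := Cr_poly hg p
  refine (remainder (R := fun s => p.eval s * RR α Q s) (K := 0) (poly_int hg p) (E := E) ?_ ?_).1 s hs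
  · intro s hs
    rw [(RR_Cr hα0 hα2 hO).1 s hs, hE s hs]
  · have h1 : (fun s => p.eval s) =O[atTop] fun s : ℝ => s ^ (2 * n + 1) := by
      have : (fun s => p.eval s) =O[atTop] fun s => (X ^ (2 * n + 1) : ℝ[X]).eval s := by
        apply Polynomial.isBigO_of_degree_le
        rw [degree_X_pow]
        exact degree_le_of_natDegree_le hp
      simpa using this
    refine (h1.mul hO).congr' EventuallyEq.rfl ?_
    filter_upwards [eventually_gt_atTop 0] with z hz
    field_simp
    ring

end HP

namespace HP

/-- zero polynomial -/
noncomputable def zp (S : Finset ℂ) (m : ℂ → ℕ) : ℝ[X] := ∏ x ∈ S, (X - C x.re) ^ m x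

lemma zp_monic (S : Finset ℂ) (m : ℂ → ℕ) : (zp S m).Monic :=
  monic_prod_of_monic _ _ fun x _ => (monic_X_sub_C _).pow _

lemma zp_deg (S : Finset ℂ) (m : ℂ → ℕ) : (zp S m).natDegree = ∑ x ∈ S, m x := by
  unfold zp
  rw [natDegree_prod_of_monic _ _ fun x _ => (monic_X_sub_C _).pow _]
  apply Finset.sum_congr rfl
  intro x _
  rw [(monic_X_sub_C _).natDegree_pow]
  simp

lemma zp_aeval {S : Finset ℂ} (hS : ∀ x ∈ S, x.im = 0) (m : ℂ → ℕ) (z : ℂ) :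
    aeval z (zp S m) = ∏ x ∈ S, (z - x) ^ m x := by
  unfold zp
  rw [map_prod]
  apply Finset.prod_congr rfl
  intro x hx
  have : ((x.re : ℝ) : ℂ) = x := by apply Complex.ext <;> simp [hS x hx]
  simp [this]

lemma zp_eval (S : Finset ℂ) (m : ℂ → ℕ) (t : ℝ) :
    (zp S m).eval t = ∏ x ∈ S, (t - x.re) ^ m x := by
  unfold zp
  rw [eval_prod]
  simp

lemma zp_root {S : Finset ℂ} (hS : ∀ x ∈ S, x.im = 0) {m : ℂ → ℕ} {z : ℂ}
    (h : aeval z (zp S m) = 0) : z ∈ S := by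
  rw [zp_aeval hS, Finset.prod_eq_zero_iff] at h
  obtain ⟨x, hx, h⟩ := h
  have h2 : z - x = 0 := eq_zero_of_pow_eq_zero h
  rw [sub_eq_zero.1 h2]
  exact hx

lemma real_zero {g : ℂ → ℂ} (hg : ContinuousOn g SU) {P : ℝ[X]} (hP : P ≠ 0) {r : ℝ → ℝ}
    (h : ∀ x ∈ Set.Ioo (-1 : ℝ) 1, ((r x : ℝ) : ℂ) = aeval (x : ℂ) P * g x) :
    ∀ x ∈ Set.Ioo (-1 : ℝ) 1, (g x).im = 0 := by
  intro x hx
  by_contra hne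
  have hc : ContinuousAt (fun x : ℝ => (g x).im) x := by
    apply Complex.continuous_im.continuousAt.comp
    exact ContinuousAt.comp (f := fun x : ℝ => (x : ℂ)) (hg.continuousAt (SU_open.mem_nhds (real_mem_SU hx)))
      Complex.continuous_ofReal.continuousAt
  have h1 := hc.eventually_ne hne
  have h2 : ∀ᶠ y in 𝓝 x, P.eval y = 0 := by
    filter_upwards [h1, isOpen_Ioo.mem_nhds hx] with y hy hy2
    have := congrArg Complex.im (h y hy2)
    rw [aeval_ofReal] at this
    simp at this
    tauto
  exact hP (Polynomial.eq_zero_of_infinite_isRoot _ (infinite_of_mem_nhds x h2))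

section
variable {α : ℝ} {f₀ ρ : ℂ → ℂ} {n : ℕ} {Q : Fin 3 → ℝ[X]} {m : ℂ → ℕ}

lemma rho_diff (hd : DifferentiableOn ℂ f₀ SU)
    (hρ : ρ = fun z : ℂ => aeval z (Q 1) + ((2 * Real.cos (α * Real.pi) : ℝ) : ℂ) * aeval z (Q 2) * f₀ z) :
    DifferentiableOn ℂ ρ SU := by
  rw [hρ]
  have h (p : ℝ[X]) : DifferentiableOn ℂ (fun z : ℂ => aeval z p) SU :=
    (Polynomial.differentiable_aeval p).differentiableOn
  exact (h _).add (((differentiableOn_const _).mul (h _)).mul hd)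

lemma m_iff (hord : ∀ x ∈ SU, (∀ j < m x, iteratedDeriv j ρ x = 0) ∧ iteratedDeriv (m x) ρ x ≠ 0)
    {x : ℂ} (hx : x ∈ SU) : m x ≠ 0 ↔ ρ x = 0 := by
  have h := hord x hx
  constructor
  · intro h0
    simpa using h.1 0 (Nat.pos_of_ne_zero h0)
  · intro h0 hm
    rw [hm] at h
    exact h.2 (by simpa using h0)

lemma noflat (hd : DifferentiableOn ℂ ρ SU)
    (hord : ∀ x ∈ SU, (∀ j < m x, iteratedDeriv j ρ x = 0) ∧ iteratedDeriv (m x) ρ x ≠ 0)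
    (h : ∀ᶠ s : ℝ in atTop, ρ ((s : ℂ)⁻¹) = 0) : False := by
  have ha : AnalyticAt ℂ ρ 0 := hd.analyticAt (SU_open.mem_nhds zero_mem_SU)
  have hinv : Tendsto (fun s : ℝ => ((s : ℂ))⁻¹) atTop (𝓝[≠] 0) := by
    apply tendsto_nhdsWithin_iff.2
    constructor
    · have := (Complex.continuous_ofReal.tendsto 0).comp (tendsto_inv_atTop_zero (𝕜 := ℝ))
      simpa [Function.comp_def] using this
    · filter_upwards [eventually_gt_atTop 0] with s hs
      simpa using hs.ne'
  have h1 : ∃ᶠ z in 𝓝[≠] (0 : ℂ), ρ z = 0 := hinv.frequently h.frequently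
  have h2 := ha.frequently_zero_iff_eventually_zero.1 h1
  apply (hord 0 zero_mem_SU).2
  have h3 : ρ =ᶠ[𝓝 0] fun _ => (0 : ℂ) := h2
  rw [h3.iteratedDeriv_eq]
  simp [iteratedDeriv_const]

lemma conj_rho (hT : Set.EqOn f₀ (fun z => 1 + (c1 α : ℂ) * (z * T (W α) z)) SU)
    (hρ : ρ = fun z : ℂ => aeval z (Q 1) + ((2 * Real.cos (α * Real.pi) : ℝ) : ℂ) * aeval z (Q 2) * f₀ z)
    {z : ℂ} (hz : z ∈ SU) : (starRingEnd ℂ z) ∈ SU ∧ ρ (starRingEnd ℂ z) = starRingEnd ℂ (ρ z) := by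
  have hz' : (starRingEnd ℂ z) ∈ SU := by
    simp only [SU, Set.mem_ofPred_eq, Complex.conj_im, Complex.conj_re, neg_eq_zero] at hz ⊢
    exact hz
  refine ⟨hz', ?_⟩
  rw [hρ]
  simp only
  rw [hT hz, hT hz']
  simp only [T_conj, Polynomial.aeval_conj, map_add, map_mul, Complex.conj_ofReal, map_one]

lemma realfac {Zr : Finset ℂ} (hd : DifferentiableOn ℂ ρ SU)
    (hord : ∀ x ∈ SU, (∀ j < m x, iteratedDeriv j ρ x = 0) ∧ iteratedDeriv (m x) ρ x ≠ 0)
    (hreal : ∀ x ∈ Set.Ioo (-1 : ℝ) 1, ρ x = (rr α Q x : ℂ))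
    (hZ : ∀ x : ℂ, x ∈ Zr ↔ x.im = 0 ∧ x ∈ SU ∧ m x ≠ 0) :
    ∃ g : ℂ → ℂ, ContinuousOn g SU ∧ (∀ z ∈ SU, ρ z = aeval z (zp Zr m) * g z) ∧
      ∃ r : ℝ → ℝ, ContinuousOn r (Set.Ioo (-1) 1) ∧
        ∀ x ∈ Set.Ioo (-1 : ℝ) 1, rr α Q x = (zp Zr m).eval x * r x ∧ r x ≠ 0 := by
  obtain ⟨g, hg, hfac, hne⟩ := factor hd m hord Zr fun x hx => ((hZ x).1 hx).2.1
  have him : ∀ x ∈ Zr, x.im = 0 := fun x hx => ((hZ x).1 hx).1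
  have hfac' : ∀ z ∈ SU, ρ z = aeval z (zp Zr m) * g z := by
    intro z hz
    rw [zp_aeval him, hfac z hz]
  refine ⟨g, hg.continuousOn, hfac', fun x => (g x).re, ?_, ?_⟩
  · apply Complex.continuous_re.comp_continuousOn
    exact hg.continuousOn.comp Complex.continuous_ofReal.continuousOn fun x hx => real_mem_SU hx
  · intro x hx
    have hi := real_zero hg.continuousOn (zp_monic Zr m).ne_zero (r := rr α Q)
      (fun x hx => by rw [← hreal x hx, hfac' _ (real_mem_SU hx)]) x hx
    have e : g x = ((g x).re : ℂ) := by apply Complex.ext <;> simp [hi]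
    constructor
    · have := hfac' x (real_mem_SU hx)
      rw [hreal x hx, aeval_ofReal, e] at this
      exact_mod_cast this
    · intro h0
      apply hne x (real_mem_SU hx)
      · by_cases h : ρ x = 0
        · left
          rw [hZ]
          exact ⟨by simp, real_mem_SU hx, (m_iff hord (real_mem_SU hx)).2 h⟩
        · exact Or.inr h
      · have h0' : (g x).re = 0 := h0
        rw [e, h0']; simp

lemma sgn (hα0 : 0 < |α|) (hα2 : |α| < 1 / 2) {p : ℝ[X]} {r : ℝ → ℝ} (hr : ContinuousOn r (Set.Ioo (-1) 1))
    (h : ∀ x ∈ Set.Ioo (-1 : ℝ) 1, rr α Q x = p.eval x * r x ∧ r x ≠ 0) (hp : p ≠ 0) :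
    ∃ ε : ℝ, ε ≠ 0 ∧ (∀ x ∈ Set.Ioo (-1 : ℝ) 1, 0 ≤ ε * (p.eval x * gg α Q x)) ∧
      0 < ε * ∫ x in Set.Ioo (-1 : ℝ) 1, p.eval x * gg α Q x := by
  have hc := c1_ne hα0 hα2
  have h00 : (0 : ℝ) ∈ Set.Ioo (-1 : ℝ) 1 := by norm_num
  have hnn : ∀ x ∈ Set.Ioo (-1 : ℝ) 1, 0 ≤ (r 0 * (c1 α)⁻¹) * (p.eval x * gg α Q x) := by
    intro x hx
    have hs := same_sign isPreconnected_Ioo hr (fun x hx => (h x hx).2) h00 hx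
    have hw := W_pos (β := α) hx
    have : (r 0 * (c1 α)⁻¹) * (p.eval x * gg α Q x) = (r 0 * r x) * (p.eval x) ^ 2 * W α x := by
      simp only [gg, (h x hx).1]
      field_simp
    rw [this]
    positivity
  have hi : IntegrableOn (fun x => (r 0 * (c1 α)⁻¹) * (p.eval x * gg α Q x)) (Set.Ioo (-1) 1) :=
    (poly_int (gg_int hα0 hα2 Q) p).const_mul _
  refine ⟨r 0 * (c1 α)⁻¹, mul_ne_zero (h 0 h00).2 (inv_ne_zero hc), hnn, ?_⟩
  rw [← integral_const_mul]
  apply lt_of_le_of_ne (setIntegral_nonneg measurableSet_Ioo hnn)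
  intro h0
  have hz := pos_int ?_ hi hnn h0.symm
  · apply hp
    apply poly_zero_Ioo
    intro x hx
    have e := hz x hx
    have hw := (W_pos (β := α) hx).ne'
    have h1 := (h 0 h00).2
    have h2 := (h x hx).2
    simp only [gg, (h x hx).1, mul_eq_zero, inv_eq_zero] at e
    tauto
  · have hcr : ContinuousOn (rr α Q) (Set.Ioo (-1) 1) := by
      unfold rr
      exact ContinuousOn.add (by fun_prop) (ContinuousOn.mul (by fun_prop) (W_cont α))
    unfold gg
    exact continuousOn_const.mul (ContinuousOn.mul (by fun_prop)
      (continuousOn_const.mul ((W_cont α).mul hcr)))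

theorem zeros (hα0 : 0 < |α|) (hα2 : |α| < 1 / 2) (hd0 : DifferentiableOn ℂ f₀ SU)
    (hp0 : ∀ z ∈ SU, (z ^ 2 - 1) * deriv f₀ z = 2 * (α : ℂ) * f₀ z) (hf0 : f₀ 0 = 1)
    (hdeg : ∀ k, (Q k).natDegree ≤ n)
    (hO : RR α Q =O[atTop] fun z : ℝ => (z ^ (2 * n + 1 + 1))⁻¹)
    (hρ : ρ = fun z : ℂ => aeval z (Q 1) + ((2 * Real.cos (α * Real.pi) : ℝ) : ℂ) * aeval z (Q 2) * f₀ z)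
    {Z : Finset ℂ} (hZ : ∀ x : ℂ, x ∈ Z ↔ x ∈ SU ∧ m x ≠ 0)
    (hord : ∀ x ∈ SU, (∀ j < m x, iteratedDeriv j ρ x = 0) ∧ iteratedDeriv (m x) ρ x ≠ 0) :
    (∀ x ∈ Z, x.im = 0 ∧ |x.re| < 1) ∧ ∑ x ∈ Z, m x = 2 * n + 1 ∧
    ∃ ε : ℝ, ε ≠ 0 ∧ (∀ x ∈ Set.Ioo (-1 : ℝ) 1, 0 ≤ ε * ((zp Z m).eval x * gg α Q x)) ∧
      0 < ε * ∫ x in Set.Ioo (-1 : ℝ) 1, (zp Z m).eval x * gg α Q x := by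
  classical
  have hT := f0_T hα0 hα2 hd0 hp0 hf0
  have hd := rho_diff hd0 hρ
  have hreal : ∀ x ∈ Set.Ioo (-1 : ℝ) 1, ρ x = (rr α Q x : ℂ) := by
    intro x hx
    rw [hρ]
    simp only [aeval_ofReal, f0_real hα0 hα2 hd0 hp0 hf0 hx, rr]
    push_cast
    ring
  set Zr := Z.filter (fun x => x.im = 0) with hZr
  have hZr' : ∀ x : ℂ, x ∈ Zr ↔ x.im = 0 ∧ x ∈ SU ∧ m x ≠ 0 := by
    intro x
    rw [hZr, Finset.mem_filter, hZ]
    tauto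
  have him : ∀ x ∈ Zr, x.im = 0 := fun x hx => ((hZr' x).1 hx).1
  obtain ⟨g, hg, hfac, r, hr, hrr⟩ := realfac hd hord hreal hZr'
  set P := zp Zr m with hP
  have hPm : P.Monic := zp_monic Zr m
  obtain ⟨ε, hε, hs1, hs2⟩ := sgn hα0 hα2 hr hrr hPm.ne_zero
  have hlow : 2 * n + 1 ≤ P.natDegree := by
    by_contra hcon
    have := moments_poly (gg_int hα0 hα2 Q) (RR_Cr hα0 hα2 hO).2 (p := P) (by omega)
    rw [this] at hs2
    simp at hs2
  have hroot : ∀ z : ℂ, aeval z P = 0 → z ∈ SU := fun z hz => ((hZr' z).1 (zp_root him hz)).2.1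
  have hup : P.natDegree ≤ 2 * n + 1 := by
    by_contra hcon
    exact noflat hd hord (upper hα0 hα2 hT (hdeg 1) (hdeg 2) hρ hPm.ne_zero hroot (by omega) hg hfac)
  have hall : ∀ x ∈ Z, x.im = 0 := by
    intro ζ hζ
    by_contra hne
    have hζ' := (hZ ζ).1 hζ
    obtain ⟨hcm, hce⟩ := conj_rho hT hρ hζ'.1
    set ζb := starRingEnd ℂ ζ with hζb
    have hmb : m ζb ≠ 0 := by
      rw [m_iff hord hcm, hce, (m_iff hord hζ'.1).1 hζ'.2, map_zero]
    have hbim : ζb.im ≠ 0 := by simpa [hζb] using hne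
    have hneb : ζ ≠ ζb := by
      intro h
      have := congrArg Complex.im h
      rw [hζb, Complex.conj_im] at this
      apply hne; linarith
    have n1 : ζb ∉ Zr := fun h => hbim (him _ h)
    have n2 : ζ ∉ insert ζb Zr := by
      rw [Finset.mem_insert]
      rintro (h | h)
      · exact hneb h
      · exact hne (him _ h)
    obtain ⟨g2, hg2, hfac2, -⟩ := factor hd m hord (insert ζ (insert ζb Zr)) (by
      intro x hx
      rw [Finset.mem_insert, Finset.mem_insert] at hx
      rcases hx with rfl | rfl | hx
      · exact hζ'.1
      · exact hcm
      · exact ((hZr' x).1 hx).2.1)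
    set D : ℝ[X] := X ^ 2 + (C (-(2 * ζ.re)) * X + C (Complex.normSq ζ)) with hD
    have hDd : (C (-(2 * ζ.re)) * X + C (Complex.normSq ζ) : ℝ[X]).degree < 2 :=
      lt_of_le_of_lt degree_linear_le (by norm_num)
    have hDm : D.Monic := monic_X_pow_add (n := 2) (by exact_mod_cast hDd)
    have hDn : D.natDegree = 2 := by
      rw [hD]
      have := natDegree_add_eq_left_of_degree_lt (p := (X ^ 2 : ℝ[X]))
        (q := C (-(2 * ζ.re)) * X + C (Complex.normSq ζ)) (by rw [degree_X_pow]; exact_mod_cast hDd)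
      rw [this, natDegree_X_pow]
    have hDe : ∀ z : ℂ, aeval z D = (z - ζ) * (z - ζb) := by
      intro z
      have e1 := Complex.mul_conj ζ
      have e2 := Complex.add_conj ζ
      rw [← hζb] at e1 e2
      simp only [hD, map_add, map_mul, map_pow, aeval_X, aeval_C, Complex.coe_algebraMap, Complex.ofReal_neg]
      rw [← e1, ← e2]
      ring
    refine noflat hd hord (upper (Pz := P * D) (g := fun z => (z - ζ) ^ (m ζ - 1) * (z - ζb) ^ (m ζb - 1) * g2 z)
      hα0 hα2 hT (hdeg 1) (hdeg 2) hρ (hPm.mul hDm).ne_zero ?_ ?_ ?_ ?_)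
    · intro z hz
      rw [map_mul, hDe, mul_eq_zero, mul_eq_zero, sub_eq_zero, sub_eq_zero] at hz
      rcases hz with hz | rfl | rfl
      · exact hroot z hz
      · exact hζ'.1
      · exact hcm
    · rw [hPm.natDegree_mul hDm, hDn]; omega
    · exact ContinuousOn.mul (by fun_prop) hg2.continuousOn
    · intro z hz
      rw [hfac2 z hz, Finset.prod_insert n2, Finset.prod_insert n1, map_mul, hP, zp_aeval him, hDe]
      obtain ⟨a, ha⟩ := Nat.exists_eq_succ_of_ne_zero hζ'.2
      obtain ⟨b, hb⟩ := Nat.exists_eq_succ_of_ne_zero hmb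
      rw [ha, hb]
      simp only [Nat.succ_eq_add_one, Nat.add_sub_cancel]
      ring
  have hZZ : Zr = Z := Finset.filter_true_of_mem hall
  rw [hZZ] at hP
  refine ⟨fun x hx => ⟨hall x hx, ?_⟩, ?_, ε, hε, ?_, ?_⟩
  · by_contra hcon
    exact ((hZ x).1 hx).1 ⟨hall x hx, not_lt.1 hcon⟩
  · rw [← zp_deg, ← hP]; omega
  · rw [← hP]; exact hs1
  · rw [← hP]; exact hs2

end

end HP

namespace HP

lemma mobius_poly {n : ℕ} {p : ℝ[X]} (hp : p.natDegree ≤ n) : ∃ A : ℝ[X], A.natDegree ≤ n ∧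
    ∀ v : ℝ, v ≠ 1 → (1 - v) ^ n * p.eval ((1 + v) / (1 - v)) = A.eval v := by
  refine ⟨∑ k ∈ Finset.range (n + 1), C (p.coeff k) * ((1 + X) ^ k * (1 - X) ^ (n - k)), ?_, ?_⟩
  · apply natDegree_sum_le_of_forall_le
    intro k hk
    have hk' : k ≤ n := Nat.lt_succ_iff.1 (Finset.mem_range.1 hk)
    refine (natDegree_C_mul_le _ _).trans (natDegree_mul_le.trans ?_)
    have h1 : ((1 + X : ℝ[X]) ^ k).natDegree ≤ k * 1 :=
      natDegree_pow_le_of_le k (by compute_degree)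
    have h2 : ((1 - X : ℝ[X]) ^ (n - k)).natDegree ≤ (n - k) * 1 :=
      natDegree_pow_le_of_le (n - k) (by compute_degree)
    omega
  · intro v hv
    have hv' : 1 - v ≠ 0 := sub_ne_zero.2 hv.symm
    rw [eval_eq_sum_range' (Nat.lt_succ_of_le hp), Finset.mul_sum, eval_finsetSum]
    apply Finset.sum_congr rfl
    intro k hk
    have hk' : k ≤ n := Nat.lt_succ_iff.1 (Finset.mem_range.1 hk)
    simp only [eval_mul, eval_C, eval_pow, eval_add, eval_one, eval_X, eval_sub]
    obtain ⟨d, rfl⟩ := Nat.exists_eq_add_of_le hk'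
    rw [Nat.add_sub_cancel_left, div_pow, pow_add]
    field_simp

lemma sum_three (F : ℕ → ℕ → ℝ) (N : ℕ) : ∑ i ∈ Finset.range (3 * N), F (i / 3) (i % 3)
    = ∑ k ∈ Finset.range N, (F k 0 + F k 1 + F k 2) := by
  induction N with
  | zero => simp
  | succ N ih =>
    rw [Finset.sum_range_succ, ← ih, show 3 * (N + 1) = 3 * N + 1 + 1 + 1 by ring,
      Finset.sum_range_succ, Finset.sum_range_succ, Finset.sum_range_succ]
    have e1 : 3 * N / 3 = N := by omega
    have e2 : (3 * N + 1) / 3 = N := by omega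
    have e3 : (3 * N + 1 + 1) / 3 = N := by omega
    have f1 : 3 * N % 3 = 0 := by omega
    have f2 : (3 * N + 1) % 3 = 1 := by omega
    have f3 : (3 * N + 1 + 1) % 3 = 2 := by omega
    rw [e1, e2, e3, f1, f2, f3]
    ring

/-- exponents -/
noncomputable def tau (α : ℝ) (i : ℕ) : ℝ := -(((i / 3 : ℕ) : ℝ) + ((i % 3 : ℕ) : ℝ) * α)

lemma tau_bd {α : ℝ} (hα2 : |α| < 1 / 2) (i : ℕ) : tau α i ≤ -(i / 3 : ℝ) + 2 ∧ -(i / 3 : ℝ) ≤ tau α i + 2 := by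
  unfold tau
  have h : (i : ℝ) = 3 * ((i / 3 : ℕ) : ℝ) + ((i % 3 : ℕ) : ℝ) := by
    exact_mod_cast (Nat.div_add_mod i 3).symm
  have h0 : (0 : ℝ) ≤ ((i % 3 : ℕ) : ℝ) := by positivity
  have h3 : ((i % 3 : ℕ) : ℝ) ≤ 2 := by
    have : i % 3 ≤ 2 := by omega
    exact_mod_cast this
  obtain ⟨a, b⟩ := abs_lt.1 hα2
  constructor <;> nlinarith

lemma H_expand {n : ℕ} {Q : Fin 3 → ℝ[X]} (α : ℝ) (hdeg : ∀ k, (Q k).natDegree ≤ n) :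
    ∃ a : ℕ → ℝ, ∀ y : ℝ, 0 < y →
      (1 - Real.exp (-y)) ^ n * RR α Q ((1 + Real.exp (-y)) / (1 - Real.exp (-y)))
        = ∑ i ∈ Finset.range (3 * n + 2 + 1), a i * Real.exp (tau α i * y) := by
  obtain ⟨A0, hA0, e0⟩ := mobius_poly (hdeg 0)
  obtain ⟨A1, hA1, e1⟩ := mobius_poly (hdeg 1)
  obtain ⟨A2, hA2, e2⟩ := mobius_poly (hdeg 2)
  set B : ℕ → ℕ → ℝ := fun k j => if j = 0 then A0.coeff k else if j = 1 then A1.coeff k else A2.coeff k with hB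
  refine ⟨fun i => B (i / 3) (i % 3), fun y hy => ?_⟩
  have hs := sum_three (fun k j => B k j * Real.exp (-((k : ℝ) + (j : ℝ) * α) * y)) (n + 1)
  have : 3 * n + 2 + 1 = 3 * (n + 1) := by ring
  rw [this]
  unfold tau
  rw [hs]
  set v := Real.exp (-y) with hv
  have hv0 : 0 < v := Real.exp_pos _
  have hv1 : v < 1 := by rw [hv, Real.exp_lt_one_iff]; linarith
  have hz : ((1 + v) / (1 - v) - 1) / ((1 + v) / (1 - v) + 1) = v := by
    have : 1 - v ≠ 0 := by linarith
    have h2 : (1 + v) / (1 - v) + 1 = 2 / (1 - v) := by field_simp; ring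
    have h1 : (1 + v) / (1 - v) - 1 = 2 * v / (1 - v) := by field_simp; ring
    rw [h1, h2]; field_simp
  unfold RR
  rw [hz, mul_add, mul_add, ← mul_assoc, ← mul_assoc, e0 v hv1.ne, e1 v hv1.ne, e2 v hv1.ne]
  rw [eval_eq_sum_range' (Nat.lt_succ_of_le hA0), eval_eq_sum_range' (Nat.lt_succ_of_le hA1),
    eval_eq_sum_range' (Nat.lt_succ_of_le hA2), Finset.sum_mul, Finset.sum_mul,
    ← Finset.sum_add_distrib, ← Finset.sum_add_distrib]
  apply Finset.sum_congr rfl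
  intro k _
  have hk : v ^ k = Real.exp (-(k * y)) := by
    rw [hv, ← Real.exp_nat_mul]; congr 1; ring
  have ha : v ^ α = Real.exp (-(α * y)) := by
    rw [hv, ← Real.exp_mul]; congr 1; ring
  simp only [hB, hk, ha]
  norm_num
  rw [mul_assoc, mul_assoc, ← Real.exp_add, ← Real.exp_nat_mul, ← Real.exp_add]
  congr 1
  · congr 1
    · congr 2; ring
  · congr 2; push_cast; ring

lemma H_U {n : ℕ} {Q : Fin 3 → ℝ[X]} {α : ℝ} (hdeg : ∀ k, (Q k).natDegree ≤ n)
    (hO : RR α Q =O[atTop] fun z : ℝ => (z ^ (2 * n + 1 + 1))⁻¹) :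
    ∃ c : ℝ, ∀ y : ℝ, 0 < y →
      (1 - Real.exp (-y)) ^ n * RR α Q ((1 + Real.exp (-y)) / (1 - Real.exp (-y)))
        = c * U (tau α) (3 * n + 2) y := by
  obtain ⟨a, ha⟩ := H_expand α hdeg
  have hv : ∀ y : ℝ, 0 < y → 0 < 1 - Real.exp (-y) := fun y hy => by
    have : Real.exp (-y) < 1 := by rw [Real.exp_lt_one_iff]; linarith
    linarith
  have hlim : Tendsto (fun y : ℝ => (1 + Real.exp (-y)) / (1 - Real.exp (-y))) (𝓝[>] 0) atTop := by
    have h1 : Tendsto (fun y : ℝ => 1 + Real.exp (-y)) (𝓝[>] 0) (𝓝 2) := by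
      have : Continuous fun y : ℝ => 1 + Real.exp (-y) := by fun_prop
      have := this.tendsto 0
      norm_num at this
      exact this.mono_left nhdsWithin_le_nhds
    have h2 : Tendsto (fun y : ℝ => 1 - Real.exp (-y)) (𝓝[>] 0) (𝓝[>] 0) := by
      apply tendsto_nhdsWithin_iff.2
      constructor
      · have : Continuous fun y : ℝ => 1 - Real.exp (-y) := by fun_prop
        have := this.tendsto 0
        norm_num at this
        exact this.mono_left nhdsWithin_le_nhds
      · filter_upwards [self_mem_nhdsWithin] with y hy
        exact hv y hy
    exact h1.pos_mul_atTop (by norm_num) h2.inv_tendsto_nhdsGT_zero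
  have hO2 := hO.comp_tendsto hlim
  have hbig : (fun y : ℝ => ∑ i ∈ Finset.range (3 * n + 2 + 1), a i * Real.exp (tau α i * y)) =O[𝓝[>] 0]
      fun y => y ^ (3 * n + 2) := by
    have h1 := (isBigO_refl (fun y : ℝ => (1 - Real.exp (-y)) ^ n) (𝓝[>] 0)).mul hO2
    refine (h1.congr' ?_ EventuallyEq.rfl).trans ?_
    · filter_upwards [self_mem_nhdsWithin] with y hy
      exact ha y hy
    · apply IsBigO.of_bound 1
      filter_upwards [self_mem_nhdsWithin] with y hy
      have hy' : 0 < y := hy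
      have hp := hv y hy'
      have he := Real.exp_pos (-y)
      simp only [Function.comp_apply]
      rw [Real.norm_of_nonneg (by positivity), Real.norm_of_nonneg (by positivity), one_mul]
      have e : (1 - Real.exp (-y)) ^ n * (((1 + Real.exp (-y)) / (1 - Real.exp (-y))) ^ (2 * n + 1 + 1))⁻¹
          = (1 - Real.exp (-y)) ^ (3 * n + 2) / (1 + Real.exp (-y)) ^ (2 * n + 1 + 1) := by
        rw [div_pow, inv_div, show 3 * n + 2 = n + (2 * n + 1 + 1) by ring, pow_add _ n]
        ring
      rw [e]
      apply (div_le_self (by positivity) (one_le_pow₀ (by linarith))).trans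
      apply pow_le_pow_left₀ hp.le
      have := Real.add_one_le_exp (-y)
      linarith
  obtain ⟨c, hc⟩ := U_unique (tau α) (3 * n + 2) a (moments_of_bigO _ _ _ _ hbig)
  exact ⟨c, fun y hy => by rw [ha y hy, hc y]⟩

end HP

namespace HP

/-- the normalized comparison function -/
noncomputable def NN (n : ℕ) (Z : Finset ℂ) (m : ℂ → ℕ) (s : ℝ) : ℝ :=
  (∏ x ∈ Z, (1 - x.re / s) ^ m x) * (s / (s + 1)) ^ (2 * n + 2) *
    (3 / (1 + ((s - 1) / (s + 1)) ^ (1 / 3 : ℝ) + (((s - 1) / (s + 1)) ^ (1 / 3 : ℝ)) ^ 2)) ^ (3 * n + 2)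

lemma v_tendsto : Tendsto (fun s : ℝ => (s - 1) / (s + 1)) atTop (𝓝 1) := by
  have h1 : Tendsto (fun s : ℝ => 1 - 2 * (s + 1)⁻¹) atTop (𝓝 (1 - 2 * 0)) :=
    tendsto_const_nhds.sub ((tendsto_inv_atTop_zero.comp (tendsto_atTop_add_const_right _ 1 tendsto_id)).const_mul 2)
  norm_num at h1
  refine h1.congr' ?_
  filter_upwards [eventually_gt_atTop 1] with s hs
  have : s + 1 ≠ 0 := by linarith
  field_simp
  ring

lemma s1_tendsto : Tendsto (fun s : ℝ => s / (s + 1)) atTop (𝓝 1) := by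
  have h1 : Tendsto (fun s : ℝ => 1 - (s + 1)⁻¹) atTop (𝓝 (1 - 0)) :=
    tendsto_const_nhds.sub (tendsto_inv_atTop_zero.comp (tendsto_atTop_add_const_right _ 1 tendsto_id))
  norm_num at h1
  refine h1.congr' ?_
  filter_upwards [eventually_gt_atTop 1] with s hs
  have : s + 1 ≠ 0 := by linarith
  field_simp
  ring

lemma s2_tendsto : Tendsto (fun s : ℝ => s / (s - 1)) atTop (𝓝 1) := by
  have h1 : Tendsto (fun s : ℝ => 1 + (s + -1)⁻¹) atTop (𝓝 (1 + 0)) :=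
    tendsto_const_nhds.add (tendsto_inv_atTop_zero.comp (tendsto_atTop_add_const_right _ (-1) tendsto_id))
  norm_num at h1
  refine h1.congr' ?_
  filter_upwards [eventually_gt_atTop 1] with s hs
  have : s + -1 ≠ 0 := by linarith
  have : s - 1 ≠ 0 := by linarith
  rw [← sub_eq_add_neg]
  field_simp
  ring

lemma NN_tendsto (n : ℕ) (Z : Finset ℂ) (m : ℂ → ℕ) : Tendsto (NN n Z m) atTop (𝓝 1) := by
  unfold NN
  have h1 : Tendsto (fun s : ℝ => ∏ x ∈ Z, (1 - x.re / s) ^ m x) atTop (𝓝 (∏ x ∈ Z, (1 - 0) ^ m x)) := by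
    apply tendsto_finsetProd
    intro x _
    apply Tendsto.pow
    apply tendsto_const_nhds.sub
    exact tendsto_const_nhds.div_atTop tendsto_id
  have h2 := s1_tendsto.pow (2 * n + 2)
  have h3 : Tendsto (fun s : ℝ => ((s - 1) / (s + 1)) ^ (1 / 3 : ℝ)) atTop (𝓝 1) := by
    have := v_tendsto.rpow_const (p := (1 / 3 : ℝ)) (Or.inr (by norm_num))
    simpa using this
  have h4 : Tendsto (fun s : ℝ => (3 : ℝ) / (1 + ((s - 1) / (s + 1)) ^ (1 / 3 : ℝ) + (((s - 1) / (s + 1)) ^ (1 / 3 : ℝ)) ^ 2))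
      atTop (𝓝 (3 / (1 + 1 + 1 ^ 2))) :=
    tendsto_const_nhds.div ((h3.const_add 1).add (h3.pow 2)) (by norm_num)
  have := (h1.mul h2).mul (h4.pow (3 * n + 2))
  norm_num at this
  simpa using this

lemma Cr_bd {h : ℝ → ℝ} {ε : ℝ} (hi : IntegrableOn h (Set.Ioo (-1) 1))
    (hpos : ∀ x ∈ Set.Ioo (-1 : ℝ) 1, 0 ≤ ε * h x) {s : ℝ} (hs : 1 < s) :
    (ε * ∫ x in Set.Ioo (-1 : ℝ) 1, h x) / (s + 1) ≤ ε * Cr h s ∧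
    ε * Cr h s ≤ (ε * ∫ x in Set.Ioo (-1 : ℝ) 1, h x) / (s - 1) := by
  unfold Cr
  have hI : IntegrableOn (fun x => ε * (h x / (s - x))) (Set.Ioo (-1) 1) := by
    apply Integrable.const_mul
    apply int_mul_cont_real hi (k := fun x => (s - x)⁻¹)
    apply ContinuousOn.inv₀ (by fun_prop)
    intro x hx
    have := hx.2
    linarith
  have hJ : IntegrableOn (fun x => ε * h x) (Set.Ioo (-1) 1) := hi.const_mul _
  rw [← integral_const_mul, ← integral_const_mul, ← integral_div, ← integral_div]
  constructor
  · apply setIntegral_mono_on (hJ.div_const _) hI measurableSet_Ioo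
    intro x hx
    rw [← mul_div_assoc]
    exact div_le_div_of_nonneg_left (hpos x hx) (by linarith [hx.2]) (by linarith [hx.1])
  · apply setIntegral_mono_on hI (hJ.div_const _) measurableSet_Ioo
    intro x hx
    rw [← mul_div_assoc]
    exact div_le_div_of_nonneg_left (hpos x hx) (by linarith [hx.2]) (by linarith [hx.2])

lemma NN_pos {n : ℕ} {Z : Finset ℂ} {m : ℂ → ℕ} (hZ : ∀ x ∈ Z, x.im = 0 ∧ |x.re| < 1) {s : ℝ} (hs : 1 < s) :
    0 < NN n Z m s := by
  unfold NN
  have hv : 0 < (s - 1) / (s + 1) := div_pos (by linarith) (by linarith)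
  have h1 : 0 < ∏ x ∈ Z, (1 - x.re / s) ^ m x := by
    apply Finset.prod_pos
    intro x hx
    apply pow_pos
    rw [sub_pos, div_lt_one (by linarith)]
    linarith [(abs_lt.1 (hZ x hx).2).2]
  positivity

theorem est {α : ℝ} {n : ℕ} {Q : Fin 3 → ℝ[X]} {Z : Finset ℂ} {m : ℂ → ℕ}
    (hα0 : 0 < |α|) (hα2 : |α| < 1 / 2)
    (hdeg : ∀ k, (Q k).natDegree ≤ n)
    (hO : RR α Q =O[atTop] fun z : ℝ => (z ^ (2 * n + 1 + 1))⁻¹)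
    (hZ : ∀ x ∈ Z, x.im = 0 ∧ |x.re| < 1) (hsum : ∑ x ∈ Z, m x = 2 * n + 1) {ε : ℝ}
    (hpos : ∀ x ∈ Set.Ioo (-1 : ℝ) 1, 0 ≤ ε * ((zp Z m).eval x * gg α Q x))
    (hS : 0 < ε * ∫ x in Set.Ioo (-1 : ℝ) 1, (zp Z m).eval x * gg α Q x) {s : ℝ} (hs : 1 < s) :
    s / (s + 1) * ((s - 1) / (s + 1)) ^ 2 ≤ NN n Z m s ∧
    NN n Z m s * ((s - 1) / (s + 1)) ^ 2 ≤ s / (s - 1) := by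
  obtain ⟨c, hc⟩ := H_U hdeg hO
  set S := ε * ∫ x in Set.Ioo (-1 : ℝ) 1, (zp Z m).eval x * gg α Q x with hSdef
  set ℓ : ℝ := 2 ^ (2 * n + 2) / (3 * n + 2).factorial with hℓ
  have hℓ0 : 0 < ℓ := by positivity
  have key : ∀ s : ℝ, 1 < s → ∃ Y : ℝ, S * (s / (s + 1)) ≤ (ε * c * ℓ) * Y ∧ (ε * c * ℓ) * Y ≤ S * (s / (s - 1)) ∧
      ((s - 1) / (s + 1)) ^ 2 * NN n Z m s ≤ Y ∧ ((s - 1) / (s + 1)) ^ 2 * Y ≤ NN n Z m s := by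
    intro s hs
    set v := (s - 1) / (s + 1) with hv
    have hs1 : s + 1 ≠ 0 := by linarith
    have hs0 : s ≠ 0 := by linarith
    have hv0 : 0 < v := div_pos (by linarith) (by linarith)
    have hv1 : v < 1 := by rw [hv, div_lt_one (by linarith)]; linarith
    have h1v : 1 - v = 2 / (s + 1) := by rw [hv]; field_simp; ring
    have h1v0 : 0 < 1 - v := by linarith
    have hsv : (1 + v) / (1 - v) = s := by
      rw [h1v, hv]; field_simp; ring
    set y := -Real.log v with hy
    have hy0 : 0 < y := by rw [hy]; linarith [Real.log_neg hv0 hv1]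
    have hey : Real.exp (-y) = v := by rw [hy, neg_neg, Real.exp_log hv0]
    have hU := hc y hy0
    rw [hey, hsv] at hU
    set r := v ^ (1 / 3 : ℝ) with hr
    have hr0 : 0 < r := Real.rpow_pos_of_pos hv0 _
    have hr3 : r ^ 3 = v := by
      rw [hr, ← Real.rpow_natCast, ← Real.rpow_mul hv0.le]; norm_num
    have her : Real.exp (-(y / 3)) = r := by
      rw [hr, Real.rpow_def_of_pos hv0]; congr 1; rw [hy]; ring
    have hUl : v ^ 2 * U (fun i => -(i / 3 : ℝ)) (3 * n + 2) y ≤ U (tau α) (3 * n + 2) y := by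
      have := U_le (τ := fun i => -(i / 3 : ℝ)) (τ' := tau α) (C := 2) (fun i => (tau_bd hα2 i).2) (3 * n + 2) hy0.le
      have e : Real.exp (2 * y) * v ^ 2 = 1 := by
        rw [← hey, ← Real.exp_nat_mul, ← Real.exp_add]
        norm_num
      calc _ ≤ v ^ 2 * (Real.exp (2 * y) * U (tau α) (3 * n + 2) y) := by gcongr
        _ = (Real.exp (2 * y) * v ^ 2) * U (tau α) (3 * n + 2) y := by ring
        _ = _ := by rw [e, one_mul]
    have hUu : v ^ 2 * U (tau α) (3 * n + 2) y ≤ U (fun i => -(i / 3 : ℝ)) (3 * n + 2) y := by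
      have := U_le (τ := tau α) (τ' := fun i => -(i / 3 : ℝ)) (C := 2) (fun i => (tau_bd hα2 i).1) (3 * n + 2) hy0.le
      have e : Real.exp (2 * y) * v ^ 2 = 1 := by
        rw [← hey, ← Real.exp_nat_mul, ← Real.exp_add]
        norm_num
      calc _ ≤ v ^ 2 * (Real.exp (2 * y) * U (fun i => -(i / 3 : ℝ)) (3 * n + 2) y) := by gcongr
        _ = (Real.exp (2 * y) * v ^ 2) * U (fun i => -(i / 3 : ℝ)) (3 * n + 2) y := by ring
        _ = _ := by rw [e, one_mul]
    set u' := U (fun i => -(i / 3 : ℝ)) (3 * n + 2) y with hu'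
    set u := U (tau α) (3 * n + 2) y with hu
    have hu'e : u' = (3 * (1 - r)) ^ (3 * n + 2) / (3 * n + 2).factorial := by
      rw [hu', U_explicit, her]
    set p := (zp Z m).eval s with hp
    have hpP : p = s ^ (2 * n + 1) * ∏ x ∈ Z, (1 - x.re / s) ^ m x := by
      rw [hp, zp_eval, ← hsum, ← Finset.prod_pow_eq_pow_sum, ← Finset.prod_mul_distrib]
      apply Finset.prod_congr rfl
      intro x _
      rw [← mul_pow]
      congr 1
      field_simp
    have hN0 := NN_pos (n := n) (m := m) hZ hs
    set k : ℝ := s * p / ((1 - v) ^ n * ℓ) with hk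
    have hkN : k * u' = NN n Z m s := by
      rw [hk, hu'e, hpP, hℓ]
      unfold NN
      rw [← hv, ← hr]
      have hq : 0 < 1 + r + r ^ 2 := by positivity
      have h1r : 1 - r = (1 - v) / (1 + r + r ^ 2) := by
        rw [← hr3]; field_simp; ring
      have e1 : (3 * (1 - r)) ^ (3 * n + 2) = (3 / (1 + r + r ^ 2)) ^ (3 * n + 2) * ((1 - v) ^ n * (1 - v) ^ (2 * n + 2)) := by
        rw [← pow_add, show n + (2 * n + 2) = 3 * n + 2 by ring, ← mul_pow, h1r]
        congr 1
        field_simp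
      have e2 : (1 - v) ^ (2 * n + 2) = 2 ^ (2 * n + 2) / (s + 1) ^ (2 * n + 2) := by rw [h1v, div_pow]
      rw [e1, e2, div_pow s]
      have hw : (1 - v) ^ n ≠ 0 := (pow_pos h1v0 n).ne'
      have hf : ((3 * n + 2).factorial : ℝ) ≠ 0 := by positivity
      have h2 : (2 : ℝ) ^ (2 * n + 2) ≠ 0 := by positivity
      have h3 : (s + 1) ^ (2 * n + 2) ≠ 0 := pow_ne_zero _ hs1
      have e3 : s ^ (2 * n + 2) = s * s ^ (2 * n + 1) := by ring
      rw [e3]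
      generalize (1 - v) ^ n = a at *
      generalize ((3 * n + 2).factorial : ℝ) = b at *
      generalize (2 : ℝ) ^ (2 * n + 2) = d at *
      generalize (s + 1) ^ (2 * n + 2) = e at *
      generalize (3 / (1 + r + r ^ 2)) ^ (3 * n + 2) = f at *
      field_simp
    have hk0 : 0 < k := by
      by_contra hcon
      have : k * u' ≤ 0 := mul_nonpos_of_nonpos_of_nonneg (not_lt.1 hcon) (U_nonneg _ _ hy0.le)
      linarith
    have hb := Cr_bd (poly_int (gg_int hα0 hα2 Q) (zp Z m)) hpos hs
    have hmain : (ε * c * ℓ) * (k * u) = s * (ε * Cr (fun x => (zp Z m).eval x * gg α Q x) s) := by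
      rw [← RR_p hα0 hα2 hO (p := zp Z m) (by rw [zp_deg, hsum]) hs, ← hp]
      have hkl : k * ((1 - v) ^ n * ℓ) = s * p := by
        rw [hk]
        have : (1 - v) ^ n * ℓ ≠ 0 := by positivity
        field_simp
      linear_combination -(ε * ℓ * k) * hU + ε * RR α Q s * hkl
    rw [← hSdef] at hb
    refine ⟨k * u, ?_, ?_, ?_, ?_⟩
    · rw [hmain]
      calc S * (s / (s + 1)) = s * (S / (s + 1)) := by ring
        _ ≤ _ := mul_le_mul_of_nonneg_left hb.1 (by linarith)
    · rw [hmain]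
      calc _ ≤ s * (S / (s - 1)) := mul_le_mul_of_nonneg_left hb.2 (by linarith)
        _ = _ := by ring
    · calc v ^ 2 * NN n Z m s = k * (v ^ 2 * u') := by rw [← hkN]; ring
        _ ≤ k * u := by gcongr
    · calc v ^ 2 * (k * u) = k * (v ^ 2 * u) := by ring
        _ ≤ k * u' := by gcongr
        _ = _ := hkN
  set K := ε * c * ℓ with hK
  have hK0 : 0 < K := by
    obtain ⟨Y, h1, h2, h3, h4⟩ := key 2 (by norm_num)
    have hN := NN_pos (n := n) (m := m) hZ (s := 2) (by norm_num)
    have hY : 0 < Y := lt_of_lt_of_le (by positivity) h3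
    have : 0 < K * Y := lt_of_lt_of_le (by positivity) h1
    exact pos_of_mul_pos_left this hY.le
  have key2 : ∀ s : ℝ, 1 < s → S * (s / (s + 1)) * ((s - 1) / (s + 1)) ^ 2 ≤ K * NN n Z m s ∧
      K * (((s - 1) / (s + 1)) ^ 2 * NN n Z m s) ≤ S * (s / (s - 1)) := by
    intro s hs
    obtain ⟨Y, h1, h2, h3, h4⟩ := key s hs
    constructor
    · calc _ ≤ (K * Y) * ((s - 1) / (s + 1)) ^ 2 := mul_le_mul_of_nonneg_right h1 (by positivity)
        _ = K * (((s - 1) / (s + 1)) ^ 2 * Y) := by ring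
        _ ≤ _ := mul_le_mul_of_nonneg_left h4 hK0.le
    · exact (mul_le_mul_of_nonneg_left h3 hK0.le).trans h2
  have hN := NN_tendsto n Z m
  have hv2 := v_tendsto.pow 2
  have hSK : S ≤ K := by
    have l1 := (s1_tendsto.const_mul S).mul hv2
    have l2 := hN.const_mul K
    norm_num at l1 l2
    exact le_of_tendsto_of_tendsto l1 l2 ((eventually_gt_atTop 1).mono fun s hs => (key2 s hs).1)
  have hKS : K ≤ S := by
    have l1 := (hv2.mul hN).const_mul K
    have l2 := s2_tendsto.const_mul S
    norm_num at l1 l2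
    exact le_of_tendsto_of_tendsto l1 l2 ((eventually_gt_atTop 1).mono fun s hs => (key2 s hs).2)
  have hSe : S = K := le_antisymm hSK hKS
  obtain ⟨k1, k2⟩ := key2 s hs
  rw [hSe] at k1 k2
  constructor
  · exact le_of_mul_le_mul_left (by linarith) hK0
  · exact le_of_mul_le_mul_left (by linarith) hK0

end HP

namespace HP

lemma log_NN {n : ℕ} {Z : Finset ℂ} {m : ℂ → ℕ} (hZ : ∀ x ∈ Z, x.im = 0 ∧ |x.re| < 1) {t : ℝ}
    (ht : 0 < t) (ht1 : t < 1) :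
    ∑ x ∈ Z, (m x : ℝ) * Real.log (1 - x.re * t) = Real.log (NN n Z m t⁻¹) + (2 * n + 2) * Real.log (1 + t)
      + (3 * n + 2) * Real.log ((1 + ((1 - t) / (1 + t)) ^ (1 / 3 : ℝ) + (((1 - t) / (1 + t)) ^ (1 / 3 : ℝ)) ^ 2) / 3) := by
  unfold NN
  have e1 : (t⁻¹ - 1) / (t⁻¹ + 1) = (1 - t) / (1 + t) := by field_simp
  have e2 : t⁻¹ / (t⁻¹ + 1) = (1 + t)⁻¹ := by field_simp
  rw [e1, e2]
  set r := ((1 - t) / (1 + t)) ^ (1 / 3 : ℝ) with hr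
  have hr0 : 0 < r := Real.rpow_pos_of_pos (div_pos (by linarith) (by linarith)) _
  have e3 : 3 / (1 + r + r ^ 2) = ((1 + r + r ^ 2) / 3)⁻¹ := by rw [inv_div]
  have hp : ∀ x ∈ Z, 0 < 1 - x.re * t := fun x hx => one_sub_pos (hZ x hx).2.le (by rw [abs_of_pos ht]; exact ht1)
  have e4 : ∏ x ∈ Z, (1 - x.re / t⁻¹) ^ m x = ∏ x ∈ Z, (1 - x.re * t) ^ m x := by
    simp only [div_inv_eq_mul]
  have hP : 0 < ∏ x ∈ Z, (1 - x.re * t) ^ m x := Finset.prod_pos fun x hx => pow_pos (hp x hx) _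
  rw [e3, e4, Real.log_mul (by positivity) (by positivity), Real.log_mul (by positivity) (by positivity),
    Real.log_pow, Real.log_pow, Real.log_inv, Real.log_inv, Real.log_prod fun x hx => (pow_pos (hp x hx) _).ne']
  simp only [Real.log_pow]
  push_cast
  ring

lemma lim_aux {B : ℝ} {L : ℕ → ℝ} (hL : ∀ n, |L n| ≤ B) (a b : ℝ) :
    Tendsto (fun n : ℕ => 1 / (2 * (n : ℝ)) * (L n + (2 * n + 2) * a + (3 * n + 2) * b)) atTop
      (𝓝 (a + 3 / 2 * b)) := by
  have hinv : Tendsto (fun n : ℕ => ((n : ℝ))⁻¹) atTop (𝓝 0) := tendsto_inv_atTop_nhds_zero_nat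
  have h1 : Tendsto (fun n : ℕ => ((n : ℝ))⁻¹ * L n) atTop (𝓝 0) := by
    apply squeeze_zero_norm (a := fun n : ℕ => ((n : ℝ))⁻¹ * B)
    · intro n
      rw [norm_mul, Real.norm_of_nonneg (by positivity : (0 : ℝ) ≤ ((n : ℝ))⁻¹)]
      exact mul_le_mul_of_nonneg_left (hL n) (by positivity)
    · simpa using hinv.mul_const B
  have h2 := ((h1.const_mul (1 / 2)).add (hinv.mul_const (a + b))).add_const (a + 3 / 2 * b)
  simp only [mul_zero, zero_mul, zero_add, add_zero] at h2
  refine h2.congr' ?_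
  filter_upwards [eventually_gt_atTop 0] with n hn
  have : (n : ℝ) ≠ 0 := by exact_mod_cast hn.ne'
  field_simp
  ring

end HP

/-- With `f` the branch of `((z−1)/(z+1))^α` (`α ∈ ℝ`, `|α| ∈ (0,1/2)`) on
`ℂ∖[−1,1]`, `f₀` the branch of `((1−z)/(1+z))^α` on `ℂ∖F` with `f₀(0)=1`, and `Q_{n,k}`
type I Hermite–Padé polynomials of order `n` for `(1,f,f²)`, set
`ρ_n = Q_{n,1} + 2cos(απ) Q_{n,2} f₀` on `ℂ∖F`.  If, for each `n`, the finitely many zeros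
of `ρ_n` in `ℂ∖F` are enumerated by the finite set `Z n` with multiplicities `m n x`
(multiplicity = order of vanishing, detected by iterated derivatives), then
`(1/2n) Σ_{x : ρ_n(x)=0} φ(x) → ∫_{−1}^{1} φ λ'` for every continuous compactly
supported `φ : ℂ → ℝ`. -/
theorem stmt_6 (α : ℝ) (hα0 : 0 < |α|) (hα2 : |α| < 1 / 2)
    (f : ℂ → ℂ)
    (hf_dom : DifferentiableOn ℂ f {z : ℂ | ¬(z.im = 0 ∧ |z.re| ≤ 1)})
    (hf_pearson : ∀ z ∈ {z : ℂ | ¬(z.im = 0 ∧ |z.re| ≤ 1)},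
      (z ^ 2 - 1) * deriv f z = 2 * (α : ℂ) * f z)
    (hf_inf : Tendsto f (cobounded ℂ) (𝓝 1))
    (f₀ : ℂ → ℂ)
    (hf₀_dom : DifferentiableOn ℂ f₀ {z : ℂ | ¬(z.im = 0 ∧ 1 ≤ |z.re|)})
    (hf₀_pearson : ∀ z ∈ {z : ℂ | ¬(z.im = 0 ∧ 1 ≤ |z.re|)},
      (z ^ 2 - 1) * deriv f₀ z = 2 * (α : ℂ) * f₀ z)
    (hf₀_0 : f₀ 0 = 1)
    (Q : ℕ → Fin 3 → Polynomial ℝ)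
    (hQ : ∀ n, ∃ k, Q n k ≠ 0)
    (hdeg : ∀ n k, (Q n k).natDegree ≤ n)
    (hHP : ∀ n, (fun z : ℂ =>
        aeval z (Q n 0) + aeval z (Q n 1) * f z + aeval z (Q n 2) * f z ^ 2)
      =O[cobounded ℂ] fun z => (z ^ (2 * n + 2))⁻¹)
    (ρ : ℕ → ℂ → ℂ)
    (hρ : ∀ n, ρ n = fun z : ℂ => aeval z (Q n 1)
      + ((2 * Real.cos (α * Real.pi) : ℝ) : ℂ) * aeval z (Q n 2) * f₀ z)
    (Z : ℕ → Finset ℂ) (m : ℕ → ℂ → ℕ)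
    (hZmem : ∀ n, ∀ x : ℂ, x ∈ Z n ↔ (x ∈ {z : ℂ | ¬(z.im = 0 ∧ 1 ≤ |z.re|)} ∧ m n x ≠ 0))
    (hZord : ∀ n, ∀ x ∈ {z : ℂ | ¬(z.im = 0 ∧ 1 ≤ |z.re|)},
      (∀ j < m n x, iteratedDeriv j (ρ n) x = 0) ∧ iteratedDeriv (m n x) (ρ n) x ≠ 0) :
    ∀ φ : ℂ → ℝ, Continuous φ → HasCompactSupport φ →
      Tendsto (fun n : ℕ => (1 / (2 * (n : ℝ))) * ∑ x ∈ Z n, (m n x : ℝ) * φ x)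
        atTop (𝓝 (∫ x in Set.Ioo (-1 : ℝ) 1, φ (x : ℂ) * lambdaDensity x)) := by
  intro φ hφ _
  have hO : ∀ n, HP.RR α (Q n) =O[atTop] fun z : ℝ => (z ^ (2 * n + 1 + 1))⁻¹ := fun n =>
    HP.RR_O hα0 hα2 hf_dom hf_pearson hf_inf (hHP n)
  have hz := fun n => HP.zeros (m := m n) (Z := Z n) hα0 hα2 hf₀_dom hf₀_pearson hf₀_0 (hdeg n) (hO n) (hρ n)
    (hZmem n) (hZord n)
  refine HP.weak_conv (fun n => (hz n).1) (fun n => (hz n).2.1) ?_ φ hφ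
  intro t ht ht1
  rw [HP.pot_eq ht ht1]
  unfold HP.Lf
  have hs : 1 < t⁻¹ := (one_lt_inv₀ ht).2 ht1
  set s := t⁻¹ with hsdef
  have hv0 : 0 < ((s - 1) / (s + 1)) ^ 2 := pow_pos (div_pos (by linarith) (by linarith)) 2
  set lo := s / (s + 1) * ((s - 1) / (s + 1)) ^ 2 with hlo
  set hi := s / (s - 1) / ((s - 1) / (s + 1)) ^ 2 with hhi
  have hlo0 : 0 < lo := mul_pos (div_pos (by linarith) (by linarith)) hv0
  have hL : ∀ n, |Real.log (HP.NN n (Z n) (m n) s)| ≤ |Real.log lo| + |Real.log hi| := by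
    intro n
    obtain ⟨h1, h2, ε, h3, h4, h5⟩ := hz n
    obtain ⟨e1, e2⟩ := HP.est hα0 hα2 (hdeg n) (hO n) h1 h2 h4 h5 hs
    have e3 : HP.NN n (Z n) (m n) s ≤ hi := (le_div_iff₀ hv0).2 e2
    have l1 := Real.log_le_log hlo0 e1
    have l2 := Real.log_le_log (lt_of_lt_of_le hlo0 e1) e3
    rw [abs_le]
    constructor
    · linarith [neg_abs_le (Real.log lo), abs_nonneg (Real.log hi)]
    · linarith [le_abs_self (Real.log hi), abs_nonneg (Real.log lo)]
  refine (HP.lim_aux hL (Real.log (1 + t)) _).congr fun n => ?_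
  rw [HP.log_NN (n := n) (hz n).1 ht ht1]
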